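/- arXiv:1112.0852 — 2 statements merged into one kernel-verified Lean document; each statement's English description precedes it below -/
import Mathlib

section
/- Let A be an artin algebra and C a component of Γ_A without projective modules and without external short paths, admitting a faithful module M in add(C). Then for every indecomposable module N in C, the injective dimension of N is at most 1. -/
universe u

variable {A : Type u} [Ring A]

/-- The category of (right) `A`-modules, modeled as modules over `Aᵐᵒᵖ`. -/
abbrev Modc (A : Type u) [Ring A] := ModuleCat.{u} Aᵐᵒᵖ

/-- A module is finitely generated. -/
def FinGen (M : Modc A) : Prop := Module.Finite Aᵐᵒᵖ M

/-- A module is indecomposable: nonzero, and its endomorphism ring has no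
nontrivial idempotents. -/
def Indec (M : Modc A) : Prop :=
  Nontrivial M ∧ ∀ e : M →ₗ[Aᵐᵒᵖ] M, e ∘ₗ e = e → e = 0 ∨ e = LinearMap.id

def IsSplitMono {M N : Modc A} (f : M →ₗ[Aᵐᵒᵖ] N) : Prop :=
  ∃ g : N →ₗ[Aᵐᵒᵖ] M, g ∘ₗ f = LinearMap.id

def IsSplitEpi {M N : Modc A} (f : M →ₗ[Aᵐᵒᵖ] N) : Prop :=
  ∃ g : N →ₗ[Aᵐᵒᵖ] M, f ∘ₗ g = LinearMap.id

/-- An irreducible morphism between modules. -/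
def IsIrred {M N : Modc A} (f : M →ₗ[Aᵐᵒᵖ] N) : Prop :=
  ¬ IsSplitMono f ∧ ¬ IsSplitEpi f ∧
  ∀ (L : Modc A) (g : M →ₗ[Aᵐᵒᵖ] L) (h : L →ₗ[Aᵐᵒᵖ] N),
    h ∘ₗ g = f → IsSplitEpi h ∨ IsSplitMono g

/-- Neighbors in the Auslander-Reiten quiver: both finitely generated
indecomposable, and isomorphic or linked by an irreducible map. -/
def Neighbor (X Y : Modc A) : Prop :=
  FinGen X ∧ FinGen Y ∧ Indec X ∧ Indec Y ∧
  (Nonempty (X ≃ₗ[Aᵐᵒᵖ] Y) ∨ (∃ f : X →ₗ[Aᵐᵒᵖ] Y, IsIrred f) ∨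
    (∃ f : Y →ₗ[Aᵐᵒᵖ] X, IsIrred f))

/-- A component of the Auslander-Reiten quiver `Γ_A`, viewed as the class of
indecomposable finitely generated modules lying in it. -/
def IsARComponent (C : Set (Modc A)) : Prop :=
  C.Nonempty ∧ (∀ X ∈ C, FinGen X ∧ Indec X) ∧
  (∀ X ∈ C, ∀ Y : Modc A, Neighbor X Y → Y ∈ C) ∧
  (∀ X ∈ C, ∀ Y ∈ C, Relation.ReflTransGen Neighbor X Y)

/-- The annihilator of a class of modules. -/
def annSet (C : Set (Modc A)) : Set A :=
  {a | ∀ X ∈ C, ∀ x : X, MulOpposite.op a • x = 0}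

/-- The annihilator of a single module. -/
def annM (M : Modc A) : Set A := {a | ∀ x : M, MulOpposite.op a • x = 0}

/-- Membership in `add C`: isomorphic to a finite direct sum of modules in `C`. -/
def InAdd (C : Set (Modc A)) (M : Modc A) : Prop :=
  ∃ (k : ℕ) (F : Fin k → Modc A), (∀ i, F i ∈ C) ∧
    Nonempty (M ≃ₗ[Aᵐᵒᵖ] ((i : Fin k) → F i))

/-- An external short path of `C`: nonzero non-isomorphisms `X → Y → Z` between
indecomposables with `X, Z ∈ C` and `Y ∉ C`. -/
def HasExtShortPath (C : Set (Modc A)) : Prop :=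
  ∃ X Y Z : Modc A, X ∈ C ∧ Z ∈ C ∧ Y ∉ C ∧ FinGen Y ∧ Indec Y ∧
    (∃ f : X →ₗ[Aᵐᵒᵖ] Y, f ≠ 0 ∧ ¬ Function.Bijective f) ∧
    (∃ g : Y →ₗ[Aᵐᵒᵖ] Z, g ≠ 0 ∧ ¬ Function.Bijective g)

/-- Projective dimension at most one. -/
def PdLE1 (X : Modc A) : Prop :=
  ∃ (P₁ P₀ : Modc A) (f : P₁ →ₗ[Aᵐᵒᵖ] P₀) (g : P₀ →ₗ[Aᵐᵒᵖ] X),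
    Module.Projective Aᵐᵒᵖ P₁ ∧ Module.Projective Aᵐᵒᵖ P₀ ∧
    Function.Injective f ∧ Function.Surjective g ∧
    LinearMap.range f = LinearMap.ker g

/-- Projective dimension at most two. -/
def PdLE2 (X : Modc A) : Prop :=
  ∃ (P₂ P₁ P₀ : Modc A) (f : P₂ →ₗ[Aᵐᵒᵖ] P₁) (g : P₁ →ₗ[Aᵐᵒᵖ] P₀)
    (h : P₀ →ₗ[Aᵐᵒᵖ] X),
    Module.Projective Aᵐᵒᵖ P₂ ∧ Module.Projective Aᵐᵒᵖ P₁ ∧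
    Module.Projective Aᵐᵒᵖ P₀ ∧
    Function.Injective f ∧ Function.Surjective h ∧
    LinearMap.range f = LinearMap.ker g ∧ LinearMap.range g = LinearMap.ker h

/-- Injective dimension at most one. -/
def IdLE1 (X : Modc A) : Prop :=
  ∃ (I₀ I₁ : Modc A) (f : X →ₗ[Aᵐᵒᵖ] I₀) (g : I₀ →ₗ[Aᵐᵒᵖ] I₁),
    Module.Injective Aᵐᵒᵖ I₀ ∧ Module.Injective Aᵐᵒᵖ I₁ ∧
    Function.Injective f ∧ Function.Surjective g ∧
    LinearMap.range f = LinearMap.ker g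

/-- An almost split (Auslander-Reiten) sequence `0 → T → E → X → 0`; then
`T = τ_A X` and `X = τ_A⁻ T`. -/
def IsAlmostSplitSeq (T E X : Modc A) (f : T →ₗ[Aᵐᵒᵖ] E) (g : E →ₗ[Aᵐᵒᵖ] X) : Prop :=
  Function.Injective f ∧ Function.Surjective g ∧
  LinearMap.range f = LinearMap.ker g ∧
  Indec T ∧ Indec X ∧ ¬ IsSplitEpi g ∧
  (∀ (V : Modc A) (h : V →ₗ[Aᵐᵒᵖ] X), ¬ IsSplitEpi h → ∃ k : V →ₗ[Aᵐᵒᵖ] E, g ∘ₗ k = h) ∧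
  (∀ (V : Modc A) (h : T →ₗ[Aᵐᵒᵖ] V), ¬ IsSplitMono h → ∃ k : E →ₗ[Aᵐᵒᵖ] V, k ∘ₗ f = h)

/-- A generator of the radical of `mod A`: a map factoring through a
non-isomorphism between finitely generated indecomposables. -/
def IsNonIsoGen {X Y : Modc A} (f : X →ₗ[Aᵐᵒᵖ] Y) : Prop :=
  ∃ (M N : Modc A) (u : M →ₗ[Aᵐᵒᵖ] N) (g : X →ₗ[Aᵐᵒᵖ] M) (h : N →ₗ[Aᵐᵒᵖ] Y),
    FinGen M ∧ Indec M ∧ FinGen N ∧ Indec N ∧ ¬ Function.Bijective u ∧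
    f = h ∘ₗ (u ∘ₗ g)

/-- The radical `rad_A(X, Y)`: the ideal of `mod A` generated by all
non-isomorphisms between indecomposables. -/
def rad1 (X Y : Modc A) : AddSubgroup (X →ₗ[Aᵐᵒᵖ] Y) :=
  AddSubgroup.closure {f | IsNonIsoGen f}

/-- Powers of the radical: `radPow n = rad_A^(n+1)`. -/
def radPow : ℕ → (X Y : Modc A) → AddSubgroup (X →ₗ[Aᵐᵒᵖ] Y)
  | 0 => rad1
  | n + 1 => fun X Y => AddSubgroup.closure
      {f | ∃ (Z : Modc A) (g : X →ₗ[Aᵐᵒᵖ] Z) (h : Z →ₗ[Aᵐᵒᵖ] Y),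
        FinGen Z ∧ g ∈ radPow n X Z ∧ h ∈ rad1 Z Y ∧ f = h ∘ₗ g}

/-- The infinite radical `rad_A^∞(X, Y) = ⋂_{i ≥ 1} rad_A^i(X, Y)`. -/
def radInf (X Y : Modc A) : AddSubgroup (X →ₗ[Aᵐᵒᵖ] Y) := ⨅ n : ℕ, radPow n X Y

/-- `X` is (isomorphic to) a direct summand of `M`. -/
def IsDirectSummandOf (X M : Modc A) : Prop :=
  ∃ (ι : X →ₗ[Aᵐᵒᵖ] M) (ρ : M →ₗ[Aᵐᵒᵖ] X), ρ ∘ₗ ι = LinearMap.id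



namespace ARComponent

section Duality

variable {K : Type u} [CommRing K]

/-- Every submodule disjoint from `U` is contained in a maximal such submodule. -/
lemma exists_maximal_disjoint {R : Type*} {M : Type*} [Ring R] [AddCommGroup M] [Module R M]
    (U V₀ : Submodule R M) (h : Disjoint V₀ U) :
    ∃ V, V₀ ≤ V ∧ Maximal (fun V => Disjoint V U) V := by
  refine zorn_le_nonempty₀ {V | Disjoint V U} (fun c hc hchain y hy => ?_) V₀ h
  exact ⟨sSup c, (hchain.directedOn.disjoint_sSup_left).2 fun V hV => hc hV,
    fun V hV => le_sSup hV⟩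

/-- Injective hulls exist: every submodule `T` of an injective module lies in an injective
submodule over which `T` is essential. -/
lemma exists_injective_hull {R : Type u} {I : Type u} [Ring R] [AddCommGroup I] [Module R I]
    [Module.Injective R I] (T : Submodule R I) :
    ∃ E : Submodule R I, T ≤ E ∧ Module.Injective R E ∧
      ∀ L ≤ E, Disjoint L T → L = ⊥ := by
  obtain ⟨U, -, hU⟩ := exists_maximal_disjoint T ⊥ disjoint_bot_left
  obtain ⟨E, hTE, hE⟩ := exists_maximal_disjoint U T hU.prop.symm
  have hess : ∀ L ≤ E, Disjoint L T → L = ⊥ := by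
    intro L hL hLT
    have h1 : Disjoint (L ⊔ U) T := by
      rw [Submodule.disjoint_def] at hLT ⊢
      intro x hx hxT
      obtain ⟨l, hl, u, hu, rfl⟩ := Submodule.mem_sup.1 hx
      have hu0 : u = 0 := by
        refine Submodule.disjoint_def.1 hE.prop u ?_ hu
        have := E.sub_mem (hTE hxT) (hL hl)
        simpa using this
      subst hu0
      simp only [add_zero] at hxT ⊢
      exact hLT l hl hxT
    have h2 : L ≤ U := le_sup_left.trans (hU.le_of_ge h1 le_sup_right)
    rw [eq_bot_iff]
    exact (le_inf hL h2).trans hE.prop.le_bot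
  have hqi : Function.Injective (U.mkQ ∘ₗ E.subtype) := by
    rw [← LinearMap.ker_eq_bot, LinearMap.ker_eq_bot']
    intro x hx
    have : (x : I) ∈ U := by simpa using hx
    exact Subtype.ext (Submodule.disjoint_def.1 hE.prop x x.2 this)
  obtain ⟨ψ, hψ⟩ := Module.Injective.extension_property R I _ _ (U.mkQ ∘ₗ E.subtype) hqi E.subtype
  have hψ' : ∀ x ∈ E, ψ (U.mkQ x) = x := fun x hx => DFunLike.congr_fun hψ ⟨x, hx⟩
  have hψinj : ∀ x, ψ (U.mkQ x) = 0 → x ∈ U := by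
    intro x hx
    have h1 : Disjoint (U ⊔ (R ∙ x)) T := by
      rw [Submodule.disjoint_def]
      intro t ht htT
      obtain ⟨v, hv, y, hy, rfl⟩ := Submodule.mem_sup.1 ht
      obtain ⟨r, rfl⟩ := Submodule.mem_span_singleton.1 hy
      rw [← hψ' _ (hTE htT), map_add, map_smul, (Submodule.Quotient.mk_eq_zero U).2 hv |> fun h =>
        (show U.mkQ v = 0 from h), zero_add, map_smul, hx, smul_zero]
    exact hU.le_of_ge h1 le_sup_left (Submodule.mem_sup_right (Submodule.mem_span_singleton_self x))
  have hrange : LinearMap.range (ψ ∘ₗ U.mkQ) ≤ E := by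
    refine hE.le_of_ge (y := LinearMap.range (ψ ∘ₗ U.mkQ)) ?_ ?_
    · have h0 : Disjoint (LinearMap.range (ψ ∘ₗ U.mkQ) ⊓ U) T :=
        hU.prop.mono_left inf_le_right
      rw [Submodule.disjoint_def]
      rintro _ ⟨x, rfl⟩ hxU
      by_contra hne
      have hxnU : x ∉ U := fun hx => hne (by
        simp [(Submodule.Quotient.mk_eq_zero U).2 hx])
      have h1 : ¬ Disjoint (U ⊔ (R ∙ x)) T := fun h1 =>
        hxnU (hU.le_of_ge h1 le_sup_left
          (Submodule.mem_sup_right (Submodule.mem_span_singleton_self x)))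
      rw [Submodule.disjoint_def] at h1
      push Not at h1
      obtain ⟨t, ht, htT, ht0⟩ := h1
      obtain ⟨v, hv, y, hy, rfl⟩ := Submodule.mem_sup.1 ht
      obtain ⟨r, rfl⟩ := Submodule.mem_span_singleton.1 hy
      apply ht0
      have h2 := hψ' _ (hTE htT)
      rw [map_add, map_smul, (Submodule.Quotient.mk_eq_zero U).2 hv |> fun h =>
        (show U.mkQ v = 0 from h), zero_add, map_smul] at h2
      refine Submodule.disjoint_def.1 hU.prop _ ?_ htT
      rw [← h2]
      exact U.smul_mem _ hxU
    · intro x hx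
      exact ⟨x, hψ' x hx⟩
  refine ⟨E, hTE, ⟨fun X Y _ _ _ _ f hf g => ?_⟩, hess⟩
  obtain ⟨h, hh⟩ := Module.Injective.extension_property R I _ _ f hf (E.subtype ∘ₗ g)
  refine ⟨(ψ ∘ₗ U.mkQ).codRestrict E (fun x => hrange ⟨x, rfl⟩) ∘ₗ h, fun x => ?_⟩
  have := DFunLike.congr_fun hh x
  apply Subtype.ext
  simp only [LinearMap.comp_apply, LinearMap.codRestrict_apply] at this ⊢
  rw [this]
  exact hψ' _ (g x).2

lemma exists_injective_embedding (R : Type u) [Ring R] (M : Type u) [AddCommGroup M]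
    [Module R M] : ∃ (I : Type u) (_ : AddCommGroup I) (_ : Module R I) (f : M →ₗ[R] I),
      Module.Injective R I ∧ Function.Injective f := by
  obtain ⟨⟨J⟩⟩ := CategoryTheory.EnoughInjectives.presentation (ModuleCat.of R M)
  rename_i hJ f hf
  refine ⟨J, inferInstance, inferInstance, f.hom, ?_, (ModuleCat.mono_iff_injective f).1 hf⟩
  exact Module.injective_module_of_injective_object R J

/-- An injective cogenerator whose dual does not increase length. -/
structure IsDualizing (K : Type u) [CommRing K] (E : Type u) [AddCommGroup E] [Module K E] :
    Prop where
  injective : Module.Injective K E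
  length_le : ∀ (S : Type u) [AddCommGroup S] [Module K S], IsSimpleModule K S →
    Module.length K (S →ₗ[K] E) ≤ 1
  exists_ne : ∀ (S : Type u) [AddCommGroup S] [Module K S], IsSimpleModule K S →
    ∃ f : S →ₗ[K] E, f ≠ 0

lemma exists_isDualizing (K : Type u) [CommRing K] :
    ∃ (E : Type u) (_ : AddCommGroup E) (_ : Module K E), IsDualizing K E := by
  classical
  obtain ⟨I, _, _, i, hI, hi⟩ :=
    exists_injective_embedding K (∀ m : MaximalSpectrum K, K ⧸ m.asIdeal)
  obtain ⟨E, hTE, hE, hess⟩ := exists_injective_hull (LinearMap.range i)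
  refine ⟨E, inferInstance, inferInstance, hE, fun S _ _ hS => ?_, fun S _ _ hS => ?_⟩
  · obtain ⟨m, hm, ⟨e⟩⟩ := isSimpleModule_iff_quot_maximal.1 hS
    let M : MaximalSpectrum K := ⟨m, hm⟩
    have hsimple : IsSimpleModule K (K ⧸ m) := isSimpleModule_iff_quot_maximal.2
      ⟨m, hm, ⟨LinearEquiv.refl _ _⟩⟩
    have hT : ∀ f : S →ₗ[K] E, ∀ s, ((f s : E) : I) ∈ LinearMap.range i := by
      intro f s
      by_cases hs : f = 0
      · subst hs; simp
      have hinj : Function.Injective f := (LinearMap.injective_or_eq_zero f).resolve_right hs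
      by_contra hcon
      have hd : Disjoint (LinearMap.range (E.subtype ∘ₗ f)) (LinearMap.range i) := by
        have : IsSimpleModule K (LinearMap.range (E.subtype ∘ₗ f)) :=
          IsSimpleModule.congr (LinearEquiv.ofInjective (E.subtype ∘ₗ f)
            (E.injective_subtype.comp hinj)).symm
        have hat := (isSimpleModule_iff_isAtom (R := K)).1 this
        rcases hat.le_iff.1 (inf_le_left :
          LinearMap.range (E.subtype ∘ₗ f) ⊓ LinearMap.range i ≤ _) with h | h
        · exact disjoint_iff.2 h
        · exact absurd (inf_eq_left.1 h ⟨s, rfl⟩) hcon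
      have h0 := hess _ (by rintro _ ⟨y, rfl⟩; exact (f y).2) hd
      apply hs
      ext y
      have : (E.subtype ∘ₗ f) y ∈ LinearMap.range (E.subtype ∘ₗ f) := ⟨y, rfl⟩
      rw [h0] at this
      simpa using this
    let j : LinearMap.range i ≃ₗ[K] (∀ m : MaximalSpectrum K, K ⧸ m.asIdeal) :=
      (LinearEquiv.ofInjective i hi).symm
    let x : S := e.symm 1
    let Φ : (S →ₗ[K] E) →ₗ[K] K ⧸ m :=
      { toFun := fun f => j ⟨_, hT f x⟩ M
        map_add' := fun f g => by
          rw [show (⟨_, hT (f + g) x⟩ : LinearMap.range i) = ⟨_, hT f x⟩ + ⟨_, hT g x⟩ from rfl,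
            map_add]; rfl
        map_smul' := fun r f => by
          rw [show (⟨_, hT (r • f) x⟩ : LinearMap.range i) = r • ⟨_, hT f x⟩ from rfl,
            map_smul]; rfl }
    have hΦ : Function.Injective Φ := by
      rw [injective_iff_map_eq_zero]
      intro f hf
      have hmx : ∀ r ∈ m, r • x = 0 := by
        intro r hr
        rw [← map_smul]
        have : (r • (1 : K ⧸ m)) = 0 := by
          rw [Algebra.smul_def, mul_one]
          exact Ideal.Quotient.eq_zero_iff_mem.2 hr
        rw [this, map_zero]
      have hz : j ⟨_, hT f x⟩ = 0 := by
        funext M'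
        by_cases hMM : M' = M
        · subst hMM; exact hf
        · have hne : ¬ m ≤ M'.asIdeal := fun h => hMM
            (MaximalSpectrum.ext (hm.eq_of_le M'.isMaximal.ne_top h).symm)
          obtain ⟨r, hr, hrM⟩ := SetLike.not_le_iff_exists.1 hne
          have h1 : r • j ⟨_, hT f x⟩ = 0 := by
            rw [← map_smul]
            have : r • (⟨_, hT f x⟩ : LinearMap.range i) = 0 := by
              apply Subtype.ext
              change ((r • f x : E) : I) = 0
              rw [← map_smul, hmx r hr, map_zero]; rfl
            rw [this, map_zero]
          have h2 := congrFun h1 M'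
          have hmax := M'.isMaximal
          have hprime := hmax.isPrime
          rw [Pi.smul_apply, Algebra.smul_def, Pi.zero_apply, mul_eq_zero] at h2
          exact h2.resolve_left fun h => hrM (Ideal.Quotient.eq_zero_iff_mem.1 h)
      have hfx : f x = 0 := by
        have := j.map_eq_zero_iff.1 hz
        exact Subtype.ext (congrArg (fun z : LinearMap.range i => (z : I)) this)
      refine (LinearMap.injective_or_eq_zero f).resolve_left fun hinj => ?_
      have : x = 0 := hinj (by rw [hfx, map_zero])
      exact one_ne_zero (e.symm.map_eq_zero_iff.1 this)
    exact (Module.length_le_of_injective Φ hΦ).trans (Module.length_eq_one K _).le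
  · obtain ⟨m, hm, ⟨e⟩⟩ := isSimpleModule_iff_quot_maximal.1 hS
    let M : MaximalSpectrum K := ⟨m, hm⟩
    let l : K ⧸ m →ₗ[K] ∀ m : MaximalSpectrum K, K ⧸ m.asIdeal :=
      LinearMap.single K (fun m : MaximalSpectrum K => K ⧸ m.asIdeal) M
    refine ⟨(i ∘ₗ l ∘ₗ e.toLinearMap).codRestrict E fun y => hTE ⟨_, rfl⟩, fun h => ?_⟩
    have h1 := congrArg Subtype.val (DFunLike.congr_fun h (e.symm 1))
    have h2 : i (l 1) = 0 := by simpa using h1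
    have h3 := congrFun (hi (h2.trans (map_zero i).symm)) M
    simp [l, M] at h3

section

variable {E : Type u} [AddCommGroup E] [Module K E]

lemma IsDualizing.extend (hE : IsDualizing K E)
    {X Y : Type u} [AddCommGroup X] [AddCommGroup Y] [Module K X]
    [Module K Y] (f : X →ₗ[K] Y) (hf : Function.Injective f) (g : X →ₗ[K] E) :
    ∃ h : Y →ₗ[K] E, h ∘ₗ f = g :=
  have := hE.injective
  Module.Injective.extension_property K E _ _ f hf g

lemma IsDualizing.exists_apply_ne (hE : IsDualizing K E)
    {M : Type u} [AddCommGroup M] [Module K M] {x : M}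
    (hx : x ≠ 0) : ∃ f : M →ₗ[K] E, f x ≠ 0 := by
  have hann : Ideal.torsionOf K M x ≠ ⊤ := fun h => hx ((Ideal.torsionOf_eq_top_iff (R := K) x).1 h)
  obtain ⟨m, hm, hle⟩ := Ideal.exists_le_maximal _ hann
  have hsimple : IsSimpleModule K (K ⧸ m) := isSimpleModule_iff_quot_maximal.2
    ⟨m, hm, ⟨LinearEquiv.refl _ _⟩⟩
  obtain ⟨f, hf⟩ := hE.exists_ne (K ⧸ m) hsimple
  let q : (K ⧸ Ideal.torsionOf K M x) →ₗ[K] K ⧸ m := Submodule.factor hle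
  obtain ⟨h, hh⟩ := hE.extend (K ∙ x).subtype (Submodule.injective_subtype _)
    (f ∘ₗ q ∘ₗ (Ideal.quotTorsionOfEquivSpanSingleton K M x).symm.toLinearMap)
  refine ⟨h, fun h0 => hf ?_⟩
  have h1 := DFunLike.congr_fun hh ⟨x, Submodule.mem_span_singleton_self x⟩
  have h2 : (Ideal.quotTorsionOfEquivSpanSingleton K M x).symm
      ⟨x, Submodule.mem_span_singleton_self x⟩ = Ideal.Quotient.mk _ 1 := by
    rw [LinearEquiv.symm_apply_eq]
    apply Subtype.ext
    exact (one_smul K x).symm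
  have h3 : f 1 = 0 := by
    rw [← h0]
    refine Eq.trans ?_ h1.symm
    simp only [LinearMap.comp_apply, LinearEquiv.coe_coe, h2]
    rfl
  refine LinearMap.ext fun y => ?_
  obtain ⟨r, rfl⟩ := Ideal.Quotient.mk_surjective y
  have : (Ideal.Quotient.mk m r) = r • (1 : K ⧸ m) := by
    rw [Algebra.smul_def, mul_one]; rfl
  rw [this, map_smul, h3, smul_zero, LinearMap.zero_apply]

lemma IsDualizing.length_dual_le (hE : IsDualizing K E)
    {M : Type u} [AddCommGroup M] [Module K M]
    (hM : IsFiniteLength K M) : Module.length K (M →ₗ[K] E) ≤ Module.length K M := by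
  induction hM with
  | of_subsingleton => simp [Module.length_eq_zero]
  | @of_simple_quotient M _ _ N hs _ ih =>
    let r : (M →ₗ[K] E) →ₗ[K] (N →ₗ[K] E) := LinearMap.lcomp K E N.subtype
    let q : ((M ⧸ N) →ₗ[K] E) →ₗ[K] (M →ₗ[K] E) := LinearMap.lcomp K E N.mkQ
    have hq : Function.Injective q := by
      intro f g hfg
      exact Submodule.linearMap_qext N hfg
    have hr : Function.Surjective r := fun g =>
      hE.extend N.subtype (Submodule.injective_subtype _) g
    have hex : Function.Exact q r := by
      intro f
      constructor
      · intro hf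
        refine ⟨N.liftQ f fun x hx => LinearMap.mem_ker.2 (DFunLike.congr_fun hf ⟨x, hx⟩), ?_⟩
        ext; rfl
      · rintro ⟨g, rfl⟩
        ext x
        change g (N.mkQ x) = 0
        rw [Submodule.mkQ_apply, (Submodule.Quotient.mk_eq_zero N).2 x.2, map_zero]
    rw [Module.length_eq_add_of_exact q r hq hr hex,
      Module.length_eq_add_of_exact N.subtype N.mkQ (Submodule.injective_subtype _)
        (Submodule.mkQ_surjective _) (LinearMap.exact_subtype_mkQ N), add_comm]
    refine add_le_add ih ?_
    rw [Module.length_eq_one K (M ⧸ N)]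
    exact hE.length_le _ hs

lemma IsDualizing.finite_dual (hE : IsDualizing K E)
    [IsArtinianRing K] (M : Type u) [AddCommGroup M] [Module K M]
    [Module.Finite K M] : Module.Finite K (M →ₗ[K] E) := by
  have h : IsFiniteLength K M := isFiniteLength_iff_isNoetherian_isArtinian.2
    ⟨inferInstance, inferInstance⟩
  have h1 := (hE.length_dual_le h).trans_lt (Module.length_ne_top_iff.2 h).lt_top
  have := (isFiniteLength_iff_isNoetherian_isArtinian.1 (Module.length_ne_top_iff.1 h1.ne)).1
  infer_instance

lemma IsDualizing.eval_surjective (hE : IsDualizing K E)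
    [IsArtinianRing K] (M : Type u) [AddCommGroup M] [Module K M]
    [Module.Finite K M] (c : (M →ₗ[K] E) →ₗ[K] E) : ∃ x : M, ∀ f, c f = f x := by
  have hfin := hE.finite_dual M
  have h : IsFiniteLength K M := isFiniteLength_iff_isNoetherian_isArtinian.2
    ⟨inferInstance, inferInstance⟩
  have h' : IsFiniteLength K (M →ₗ[K] E) := isFiniteLength_iff_isNoetherian_isArtinian.2
    ⟨inferInstance, inferInstance⟩
  have hfin' := hE.finite_dual (M →ₗ[K] E)
  let ev : M →ₗ[K] ((M →ₗ[K] E) →ₗ[K] E) := LinearMap.applyₗ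
  have hinj : Function.Injective ev := by
    rw [injective_iff_map_eq_zero]
    intro x hx
    by_contra hne
    obtain ⟨f, hf⟩ := hE.exists_apply_ne hne
    exact hf (DFunLike.congr_fun hx f)
  have hle := (hE.length_dual_le h').trans (hE.length_dual_le h)
  have htop : LinearMap.range ev = ⊤ := by
    by_contra hne
    have := Submodule.length_lt hne
    rw [← (LinearEquiv.ofInjective ev hinj).length_eq] at this
    exact absurd hle this.not_ge
  obtain ⟨x, hx⟩ := LinearMap.range_eq_top.1 htop c
  exact ⟨x, fun f => by rw [← hx]; rfl⟩

end

end Duality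

section Nakayama

variable (K R E : Type u) [CommRing K] [Ring R] [Algebra K R] [AddCommGroup E] [Module K E]

/-- The dual `Hom_K(R, E)` of the regular right module, as a left `R`-module. -/
def RegularDual : Type u := R →ₗ[K] E

instance : AddCommGroup (RegularDual K R E) := inferInstanceAs (AddCommGroup (R →ₗ[K] E))

instance : Module K (RegularDual K R E) := inferInstanceAs (Module K (R →ₗ[K] E))

instance : Module R (RegularDual K R E) where
  smul r f := LinearMap.comp (show R →ₗ[K] E from f) (LinearMap.mulRight K r)
  one_smul f := LinearMap.ext fun x => congrArg (show R →ₗ[K] E from f) (mul_one x)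
  mul_smul r s f := LinearMap.ext fun x =>
    congrArg (show R →ₗ[K] E from f) (mul_assoc x r s).symm
  smul_zero _ := LinearMap.ext fun _ => rfl
  smul_add _ _ _ := LinearMap.ext fun _ => rfl
  add_smul r s f := LinearMap.ext fun x =>
    (congrArg (show R →ₗ[K] E from f) (mul_add x r s)).trans (map_add _ _ _)
  zero_smul f := LinearMap.ext fun x =>
    (congrArg (show R →ₗ[K] E from f) (mul_zero x)).trans (map_zero _)

instance : IsScalarTower K R (RegularDual K R E) where
  smul_assoc k r f := LinearMap.ext fun x =>
    (congrArg (show R →ₗ[K] E from f) (mul_smul_comm k x r)).trans (map_smul _ _ _)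

/-- The data of an injective cogenerator `I` over `R` with `Hom_R(-, I) = Hom_K(-, E)` via `ε`,
for which every functional on `I` is evaluation at an element of `R`. -/
structure IsRegularDual (I : Type u) [AddCommGroup I] [Module R I] [Module K I]
    (ε : I →ₗ[K] E) : Prop where
  lift : ∀ (V : Type u) [AddCommGroup V] [Module R V] [Module K V] [IsScalarTower K R V]
    (c : V →ₗ[K] E), ∃ u : V →ₗ[R] I, ∀ v, ε (u v) = c v
  eq_zero : ∀ x : I, (∀ r : R, ε (r • x) = 0) → x = 0
  eval : ∀ c : I →ₗ[K] E, ∃ r : R, ∀ x, c x = ε (r • x)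

variable {K R E}

lemma IsDualizing.exists_isRegularDual [IsArtinianRing K] [Module.Finite K R]
    (hE : IsDualizing K E) :
    ∃ ε : RegularDual K R E →ₗ[K] E, IsRegularDual K R E (RegularDual K R E) ε := by
  let ε : RegularDual K R E →ₗ[K] E :=
    { toFun := fun f => (show R →ₗ[K] E from f) 1
      map_add' := fun f g => rfl
      map_smul' := fun k f => rfl }
  have hε : ∀ (r : R) (f : RegularDual K R E), ε (r • f) = (show R →ₗ[K] E from f) r :=
    fun r f => congrArg (show R →ₗ[K] E from f) (one_mul r)
  refine ⟨ε, fun V _ _ _ _ c => ⟨?_, ?_⟩, fun x hx => ?_, fun c => ?_⟩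
  · exact
      { toFun := fun v =>
          show R →ₗ[K] E from c ∘ₗ (LinearMap.toSpanSingleton R V v).restrictScalars K
        map_add' := fun v w => LinearMap.ext fun r =>
          (congrArg c (smul_add r v w)).trans (map_add _ _ _)
        map_smul' := fun s v => LinearMap.ext fun r =>
          congrArg c (mul_smul r s v).symm }
  · intro v
    exact congrArg c (one_smul R v)
  · exact LinearMap.ext fun r => (hε r x).symm.trans (hx r)
  · obtain ⟨r, hr⟩ := hE.eval_surjective R c
    exact ⟨r, fun x => (hr x).trans (hε r x).symm⟩

lemma IsDualizing.finite_regularDual [IsArtinianRing K] [Module.Finite K R]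
    (hE : IsDualizing K E) : Module.Finite R (RegularDual K R E) := by
  have : Module.Finite K (RegularDual K R E) := hE.finite_dual R
  exact Module.Finite.of_restrictScalars_finite K R _

lemma isScalarTower_compHom (V : Type u) [AddCommGroup V] [Module R V] :
    letI := Module.compHom V (algebraMap K R)
    IsScalarTower K R V := by
  let _ := Module.compHom V (algebraMap K R)
  exact ⟨fun k r v => by rw [Algebra.smul_def, mul_smul]; rfl⟩

section

variable {I : Type u} [AddCommGroup I] [Module R I] [Module K I] {ε : I →ₗ[K] E}

lemma IsRegularDual.hom_ext (hI : IsRegularDual K R E I ε)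
    {V : Type u} [AddCommGroup V] [Module R V] {u w : V →ₗ[R] I}
    (h : ∀ v, ε (u v) = ε (w v)) : u = w := by
  refine LinearMap.ext fun v => sub_eq_zero.1 (hI.eq_zero _ fun r => ?_)
  rw [smul_sub, ← map_smul, ← map_smul, map_sub, h, sub_self]

lemma IsRegularDual.injective (hI : IsRegularDual K R E I ε)
    (hE : IsDualizing K E) [IsScalarTower K R I] :
    Module.Injective R I := by
  refine ⟨fun X Y _ _ _ _ f hf g => ?_⟩
  let _ := Module.compHom X (algebraMap K R)
  let _ := Module.compHom Y (algebraMap K R)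
  have := isScalarTower_compHom (K := K) (R := R) X
  have := isScalarTower_compHom (K := K) (R := R) Y
  obtain ⟨c, hc⟩ := hE.extend (f.restrictScalars K) hf (ε ∘ₗ g.restrictScalars K)
  obtain ⟨h, hh⟩ := hI.lift Y c
  refine ⟨h, fun x => DFunLike.congr_fun (hI.hom_ext (u := h ∘ₗ f) (w := g) fun x => ?_) x⟩
  exact (hh (f x)).trans (DFunLike.congr_fun hc x)

lemma IsRegularDual.exists_apply_ne (hI : IsRegularDual K R E I ε)
    (hE : IsDualizing K E) {V : Type u} [AddCommGroup V]
    [Module R V] {x : V} (hx : x ≠ 0) : ∃ u : V →ₗ[R] I, u x ≠ 0 := by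
  let _ := Module.compHom V (algebraMap K R)
  have := isScalarTower_compHom (K := K) (R := R) V
  obtain ⟨c, hc⟩ := hE.exists_apply_ne hx
  obtain ⟨u, hu⟩ := hI.lift V c
  exact ⟨u, fun h => hc (by rw [← hu, h, map_zero])⟩

lemma IsRegularDual.exists_embedding (hI : IsRegularDual K R E I ε)
    (hE : IsDualizing K E) (V : Type u) [AddCommGroup V]
    [Module R V] [IsArtinian R V] : ∃ (n : ℕ) (f : V →ₗ[R] (Fin n → I)),
      Function.Injective f := by
  obtain ⟨_, ⟨n, f, rfl⟩, hmin⟩ := IsArtinian.set_has_minimal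
    {L : Submodule R V | ∃ (n : ℕ) (f : V →ₗ[R] (Fin n → I)), L = LinearMap.ker f}
    ⟨_, 0, 0, rfl⟩
  refine ⟨n, f, (injective_iff_map_eq_zero f).2 fun x hx => ?_⟩
  by_contra hne
  obtain ⟨u, hu⟩ := hI.exists_apply_ne hE hne
  let g : V →ₗ[R] (Fin (n + 1) → I) :=
    LinearMap.pi (Fin.cons u fun i => LinearMap.proj i ∘ₗ f)
  have hg0 : ∀ v, g v 0 = u v := fun v => rfl
  have hgs : ∀ v i, g v (Fin.succ i) = f v i := fun v i => rfl
  refine hmin _ ⟨n + 1, g, rfl⟩ (lt_of_le_of_ne (fun v hv => ?_) fun h => hu ?_)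
  · have hv' : g v = 0 := hv
    refine LinearMap.mem_ker.2 (funext fun i => ?_)
    rw [← hgs, hv']; rfl
  · have : x ∈ LinearMap.ker g := h ▸ LinearMap.mem_ker.2 hx
    rw [← hg0, LinearMap.mem_ker.1 this]; rfl

end

end Nakayama

section Transpose

variable {K R E : Type u} [CommRing K] [Ring R] [AddCommGroup E] [Module K E]
  {I : Type u} [AddCommGroup I] [Module R I] [Module K I] {ε : I →ₗ[K] E}

/-- The cokernel of the transpose `R^n → R^m` of a map `I^n → I^m`. -/
abbrev Transpose {n m : ℕ} (ρ : Fin n → Fin m → R) : Type u :=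
  (Fin m → R) ⧸ Submodule.span R (Set.range ρ)

/-- The generator of the transpose at index `k`. -/
def Transpose.gen {n m : ℕ} (ρ : Fin n → Fin m → R) (k : Fin m) : Transpose ρ :=
  Submodule.mkQ _ (Pi.single k 1)

lemma Transpose.relation {n m : ℕ} (ρ : Fin n → Fin m → R) (i : Fin n) :
    ∑ k, ρ i k • Transpose.gen ρ k = 0 := by
  have h : ∑ k, ρ i k • Transpose.gen ρ k = Submodule.mkQ (Submodule.span R (Set.range ρ)) (ρ i) := by
    conv_rhs => rw [← Finset.univ_sum_single (ρ i)]
    rw [map_sum]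
    refine Finset.sum_congr rfl fun k _ => ?_
    rw [Transpose.gen, ← map_smul, ← Pi.single_smul, smul_eq_mul, mul_one]
  rw [h]
  exact (Submodule.Quotient.mk_eq_zero _).2 (Submodule.subset_span ⟨i, rfl⟩)

lemma Transpose.hom_ext {n m : ℕ} {ρ : Fin n → Fin m → R} {V : Type u} [AddCommGroup V]
    [Module R V] {θ η : Transpose ρ →ₗ[R] V}
    (h : ∀ k, θ (Transpose.gen ρ k) = η (Transpose.gen ρ k)) : θ = η := by
  refine Submodule.linearMap_qext _ (LinearMap.pi_ext' fun k => LinearMap.ext_ring ?_)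
  exact h k

lemma Transpose.exists_hom {n m : ℕ} {ρ : Fin n → Fin m → R} {V : Type u} [AddCommGroup V]
    [Module R V] (v : Fin m → V) (hv : ∀ i, ∑ k, ρ i k • v k = 0) :
    ∃ θ : Transpose ρ →ₗ[R] V, ∀ k, θ (Transpose.gen ρ k) = v k := by
  refine ⟨Submodule.liftQ _ (Fintype.linearCombination R v) ?_, fun k => ?_⟩
  · rw [Submodule.span_le]
    rintro _ ⟨i, rfl⟩
    exact LinearMap.mem_ker.2 ((Fintype.linearCombination_apply R v (ρ i)).trans (hv i))
  · exact (Fintype.linearCombination_apply_single R v k 1).trans (one_smul R _)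

/-- The pairing of a map `V → I^m` with maps from the transpose to `V`. -/
def pairing (ε : I →ₗ[K] E) {n m : ℕ} (ρ : Fin n → Fin m → R) {V : Type u} [AddCommGroup V]
    [Module R V] (u : V →ₗ[R] (Fin m → I)) (θ : Transpose ρ →ₗ[R] V) : E :=
  ∑ k, ε (u (θ (Transpose.gen ρ k)) k)

lemma pairing_add {n m : ℕ} (ρ : Fin n → Fin m → R) {V : Type u} [AddCommGroup V]
    [Module R V] (u : V →ₗ[R] (Fin m → I)) (θ η : Transpose ρ →ₗ[R] V) :
    pairing ε ρ u (θ + η) = pairing ε ρ u θ + pairing ε ρ u η := by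
  simp [pairing, Finset.sum_add_distrib]

lemma pairing_sum {n m : ℕ} (ρ : Fin n → Fin m → R) {V : Type u} [AddCommGroup V]
    [Module R V] (u : V →ₗ[R] (Fin m → I)) {ι : Type*} (s : Finset ι)
    (θ : ι → Transpose ρ →ₗ[R] V) :
    pairing ε ρ u (∑ i ∈ s, θ i) = ∑ i ∈ s, pairing ε ρ u (θ i) :=
  map_sum (AddMonoidHom.mk' (pairing ε ρ u) (pairing_add ρ u)) θ s

lemma pairing_comp {n m : ℕ} (ρ : Fin n → Fin m → R) {V W : Type u} [AddCommGroup V]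
    [Module R V] [AddCommGroup W] [Module R W] (u : V →ₗ[R] (Fin m → I)) (p : W →ₗ[R] V)
    (θ : Transpose ρ →ₗ[R] W) : pairing ε ρ (u ∘ₗ p) θ = pairing ε ρ u (p ∘ₗ θ) := rfl

lemma IsRegularDual.exists_matrix [Algebra K R] [IsScalarTower K R I]
    (hI : IsRegularDual K R E I ε) {n m : ℕ}
    (d : (Fin n → I) →ₗ[R] (Fin m → I)) :
    ∃ ρ : Fin n → Fin m → R, ∀ y k, ε (d y k) = ∑ i, ε (ρ i k • y i) := by
  have h : ∀ i k, ∃ r : R, ∀ x, ε (d (Pi.single i x) k) = ε (r • x) := fun i k =>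
    hI.eval (ε ∘ₗ (LinearMap.proj k ∘ₗ d ∘ₗ LinearMap.single R (fun _ => I) i).restrictScalars K)
  choose ρ hρ using h
  refine ⟨ρ, fun y k => ?_⟩
  conv_lhs => rw [← Finset.univ_sum_single y]
  rw [map_sum, Finset.sum_apply, map_sum]
  exact Finset.sum_congr rfl fun i _ => hρ i k (y i)

variable {n m : ℕ} {d : (Fin n → I) →ₗ[R] (Fin m → I)} {ρ : Fin n → Fin m → R}

lemma pairing_eq_zero (hρ : ∀ y k, ε (d y k) = ∑ i, ε (ρ i k • y i))
    {V : Type u} [AddCommGroup V] [Module R V] (w : V →ₗ[R] (Fin n → I))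
    (θ : Transpose ρ →ₗ[R] V) : pairing ε ρ (d ∘ₗ w) θ = 0 := by
  have h : ∀ i, ∑ k, ε (ρ i k • w (θ (Transpose.gen ρ k)) i) = 0 := by
    intro i
    have := congrArg (fun x => ε (w (θ x) i)) (Transpose.relation ρ i)
    simpa using this
  simp only [pairing, LinearMap.comp_apply, hρ]
  rw [Finset.sum_comm]
  exact Finset.sum_eq_zero fun i _ => h i

lemma IsRegularDual.exists_lift [Algebra K R] [IsScalarTower K R I]
    (hI : IsRegularDual K R E I ε) (hρ : ∀ y k, ε (d y k) = ∑ i, ε (ρ i k • y i))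
    (hE : IsDualizing K E)
    {V : Type u} [AddCommGroup V] [Module R V] (u : V →ₗ[R] (Fin m → I))
    (hu : ∀ θ, pairing ε ρ u θ = 0) : ∃ w : V →ₗ[R] (Fin n → I), u = d ∘ₗ w := by
  let _ := Module.compHom V (algebraMap K R)
  have := isScalarTower_compHom (K := K) (R := R) V
  let U : (Fin m → V) →ₗ[K] E :=
    ∑ k, ε ∘ₗ (LinearMap.proj k ∘ₗ u).restrictScalars K ∘ₗ LinearMap.proj k
  have hU : ∀ v, U v = ∑ k, ε (u (v k) k) := fun v => by simp [U]
  let δ : (Fin m → V) →ₗ[K] (Fin n → V) :=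
    LinearMap.pi fun i => ∑ k, (Module.toModuleEnd K (S := R) V (ρ i k)) ∘ₗ LinearMap.proj k
  have hδ : ∀ v i, δ v i = ∑ k, ρ i k • v k := fun v i => by simp [δ]
  have hker : LinearMap.ker δ ≤ LinearMap.ker U := by
    intro v hv
    obtain ⟨θ, hθ⟩ := Transpose.exists_hom (ρ := ρ) v fun i => by
      rw [← hδ, LinearMap.mem_ker.1 hv]; rfl
    have := hu θ
    simp only [pairing, hθ] at this
    exact LinearMap.mem_ker.2 ((hU v).trans this)
  obtain ⟨W, hW⟩ := hE.extend ((LinearMap.ker δ).liftQ δ le_rfl)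
    (LinearMap.ker_eq_bot.1 (Submodule.ker_liftQ_eq_bot' _ _ rfl)) ((LinearMap.ker δ).liftQ U hker)
  have hW' : ∀ v, W (δ v) = U v := fun v =>
    DFunLike.congr_fun hW (Submodule.Quotient.mk v)
  choose w hw using fun i => hI.lift V (W ∘ₗ LinearMap.single K (fun _ => V) i)
  refine ⟨LinearMap.pi w, LinearMap.ext fun v => funext fun k => ?_⟩
  have key : LinearMap.proj k ∘ₗ u = LinearMap.proj k ∘ₗ d ∘ₗ LinearMap.pi w := by
    refine hI.hom_ext fun v => ?_
    have h1 : ε (u v k) = U (Pi.single k v) := by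
      rw [hU, Finset.sum_eq_single k]
      · simp
      · intro b _ hb; simp [hb]
      · simp
    have h2 : ∀ i, δ (Pi.single k v) i = ρ i k • v := by
      intro i
      rw [hδ, Finset.sum_eq_single k]
      · simp
      · intro b _ hb; simp [hb]
      · simp
    calc ε (u v k) = W (δ (Pi.single k v)) := by rw [h1, hW']
      _ = ∑ i, W (Pi.single i (δ (Pi.single k v) i)) := by
        rw [← map_sum, Finset.univ_sum_single]
      _ = ∑ i, ε (ρ i k • w i v) := by
        refine Finset.sum_congr rfl fun i _ => ?_
        rw [h2, ← map_smul, hw]; rfl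
      _ = ε (d (fun i => w i v) k) := (hρ _ _).symm
  exact DFunLike.congr_fun key v

lemma IsRegularDual.exists_of_functional [Algebra K R] [IsScalarTower K R I]
    (hI : IsRegularDual K R E I ε) (hρ : ∀ y k, ε (d y k) = ∑ i, ε (ρ i k • y i))
    (hE : IsDualizing K E)
    {V : Type u} [AddCommGroup V] [Module R V] [Module K V] [IsScalarTower K R V]
    (φ : (Transpose ρ →ₗ[R] V) →ₗ[K] E)
    (hφ : ∀ (β : Transpose ρ →ₗ[R] R) (v : R →ₗ[R] V), φ (v ∘ₗ β) = 0) :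
    ∃ u : V →ₗ[R] (Fin m → I), (∀ θ, pairing ε ρ u θ = φ θ) ∧
      ∀ v, u v ∈ LinearMap.range d := by
  let j : (Transpose ρ →ₗ[R] V) →ₗ[K] (Fin m → V) :=
    { toFun := fun θ k => θ (Transpose.gen ρ k)
      map_add' := fun _ _ => rfl
      map_smul' := fun _ _ => rfl }
  have hj : Function.Injective j := fun θ η h => Transpose.hom_ext fun k => congrFun h k
  obtain ⟨U, hU⟩ := hE.extend j hj φ
  choose w hw using fun k => hI.lift V (U ∘ₗ LinearMap.single K (fun _ => V) k)
  have hp : ∀ θ, pairing ε ρ (LinearMap.pi w) θ = φ θ := by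
    intro θ
    rw [← hU, LinearMap.comp_apply, ← Finset.univ_sum_single (j θ), map_sum]
    exact Finset.sum_congr rfl fun k _ => hw k _
  refine ⟨LinearMap.pi w, hp, fun v => ?_⟩
  obtain ⟨y, hy⟩ := hI.exists_lift hρ hE (LinearMap.pi w ∘ₗ LinearMap.toSpanSingleton R V v)
    fun β => by rw [pairing_comp, hp, hφ]
  refine ⟨y 1, ?_⟩
  have := DFunLike.congr_fun hy 1
  simp only [LinearMap.comp_apply, LinearMap.toSpanSingleton_apply, one_smul] at this
  exact this.symm

end Transpose

section Indecomposable

variable {R : Type u} [Ring R]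

/-- A nonzero module without nontrivial idempotent endomorphisms. -/
def IsIndecomposable (R : Type u) [Ring R] (V : Type u) [AddCommGroup V] [Module R V] : Prop :=
  Nontrivial V ∧ ∀ e : V →ₗ[R] V, e ∘ₗ e = e → e = 0 ∨ e = LinearMap.id

variable {V : Type u} [AddCommGroup V] [Module R V]

lemma IsIndecomposable.isUnit_or_isNilpotent [IsArtinian R V] [IsNoetherian R V]
    (hV : IsIndecomposable R V) (e : Module.End R V) : IsUnit e ∨ IsNilpotent e := by
  obtain ⟨n, hn, hn0⟩ := ((e.eventually_isCompl_ker_pow_range_pow).and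
    (Filter.eventually_gt_atTop 0)).exists
  let q : V →ₗ[R] V := Submodule.projection _ _ hn
  have hq : q ∘ₗ q = q := LinearMap.ext fun x =>
    Submodule.projection_apply_of_mem_left hn (Submodule.projection_apply_mem hn x)
  rcases hV.2 q hq with h | h
  · left
    have hker : LinearMap.ker (e ^ n) = ⊥ := by
      rw [eq_bot_iff]
      intro x hx
      have h1 : q x = x := Submodule.projection_apply_of_mem_left hn hx
      rw [h] at h1
      exact h1.symm
    have hu : IsUnit (e ^ n) := by
      rw [Module.End.isUnit_iff]
      exact IsArtinian.bijective_of_injective_endomorphism _ (LinearMap.ker_eq_bot.1 hker)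
    exact (isUnit_pow_iff hn0.ne').1 hu
  · right
    refine ⟨n, LinearMap.ext fun x => ?_⟩
    have h1 : q x ∈ LinearMap.ker (e ^ n) := Submodule.projection_apply_mem hn x
    rw [h] at h1
    exact h1

lemma IsIndecomposable.isLocalRing [IsArtinian R V] [IsNoetherian R V]
    (hV : IsIndecomposable R V) : IsLocalRing (Module.End R V) := by
  have := hV.1
  refine IsLocalRing.of_isUnit_or_isUnit_one_sub_self fun e => ?_
  exact (hV.isUnit_or_isNilpotent e).imp_right fun h => h.isUnit_one_sub

lemma isIndecomposable_or_split (e : V →ₗ[R] V) (he : e ∘ₗ e = e) (h0 : e ≠ 0) :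
    IsIndecomposable R (LinearMap.range e) ∨ ∃ a b : V →ₗ[R] V, a ∘ₗ a = a ∧ b ∘ₗ b = b ∧
      a + b = e ∧ LinearMap.range a < LinearMap.range e ∧
      LinearMap.range b < LinearMap.range e := by
  have hnt : Nontrivial (LinearMap.range e) := by
    rw [Submodule.nontrivial_iff_ne_bot]
    exact fun h => h0 (LinearMap.range_eq_bot.1 h)
  have hee : ∀ x, e (e x) = e x := DFunLike.congr_fun he
  refine or_iff_not_imp_left.2 fun h => ?_
  unfold IsIndecomposable at h
  push Not at h
  obtain ⟨q, hq, hq0, hq1⟩ := h hnt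
  have hqq : ∀ x, q (q x) = q x := DFunLike.congr_fun hq
  let a : V →ₗ[R] V := (LinearMap.range e).subtype ∘ₗ q ∘ₗ e.rangeRestrict
  have hfix : ∀ x : LinearMap.range e, e.rangeRestrict x = x := by
    rintro ⟨_, y, rfl⟩
    exact Subtype.ext (hee y)
  have ha : ∀ x, a x = q (e.rangeRestrict x) := fun x => rfl
  have haa : ∀ x, a (a x) = a x := fun x => by rw [ha, ha, hfix, hqq]
  have hea : ∀ x, e (a x) = a x := fun x => congrArg Subtype.val (hfix (q (e.rangeRestrict x)))
  have hae : ∀ x, a (e x) = a x := fun x => by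
    rw [ha, ha]
    exact congrArg (fun z => (q z : V)) (hfix (e.rangeRestrict x))
  refine ⟨a, e - a, LinearMap.ext haa, LinearMap.ext fun x => ?_, by abel, ?_, ?_⟩
  · simp [hee, hea, hae, haa]
  · refine lt_of_le_of_ne ?_ fun h => hq1 (LinearMap.ext fun x => ?_)
    · rintro _ ⟨x, rfl⟩
      exact ⟨_, hea x⟩
    · obtain ⟨y, hy⟩ : (x : V) ∈ LinearMap.range a := by rw [h]; exact x.2
      have : a x = x := by rw [← hy, haa]
      rw [ha, hfix] at this
      exact Subtype.ext this
  · refine lt_of_le_of_ne ?_ fun h => hq0 (LinearMap.ext fun x => ?_)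
    · rintro _ ⟨x, rfl⟩
      exact ⟨x - a x, by simp [hea]⟩
    · obtain ⟨y, hy⟩ : (x : V) ∈ LinearMap.range (e - a) := by rw [h]; exact x.2
      have : a x = 0 := by rw [← hy]; simp [hae, haa]
      rw [ha, hfix] at this
      exact Subtype.ext this

/-- Every idempotent endomorphism of an artinian module is a finite sum of idempotents with
indecomposable images. -/
lemma exists_sum_indecomposable_of_idempotent [IsArtinian R V] (e : V →ₗ[R] V)
    (he : e ∘ₗ e = e) :
    ∃ (ι : Type) (_ : Fintype ι) (p : ι → V →ₗ[R] V), (∀ i, p i ∘ₗ p i = p i) ∧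
      (∀ i, IsIndecomposable R (LinearMap.range (p i))) ∧ ∑ i, p i = e := by
  induction h : LinearMap.range e using WellFoundedLT.induction generalizing e with
  | _ L ih =>
    subst h
    by_cases h0 : e = 0
    · exact ⟨Empty, inferInstance, Empty.elim, fun i => i.elim, fun i => i.elim, by simp [h0]⟩
    rcases isIndecomposable_or_split e he h0 with h | ⟨a, b, ha, hb, hab, hla, hlb⟩
    · exact ⟨Unit, inferInstance, fun _ => e, fun _ => he, fun _ => h, by simp⟩
    · obtain ⟨ι, _, p, hp1, hp2, hp3⟩ := ih _ hla a ha rfl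
      obtain ⟨κ, _, q, hq1, hq2, hq3⟩ := ih _ hlb b hb rfl
      refine ⟨ι ⊕ κ, inferInstance, Sum.elim p q, ?_, ?_, ?_⟩
      · rintro (i | i)
        exacts [hp1 i, hq1 i]
      · rintro (i | i)
        exacts [hp2 i, hq2 i]
      · simp [hp3, hq3, hab]

lemma exists_sum_indecomposable (R : Type u) [Ring R] (V : Type u) [AddCommGroup V] [Module R V]
    [IsArtinian R V] :
    ∃ (ι : Type) (_ : Fintype ι) (p : ι → V →ₗ[R] V), (∀ i, p i ∘ₗ p i = p i) ∧
      (∀ i, IsIndecomposable R (LinearMap.range (p i))) ∧ ∑ i, p i = LinearMap.id :=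
  exists_sum_indecomposable_of_idempotent LinearMap.id rfl

lemma rangeRestrict_comp_subtype {p : V →ₗ[R] V} (hp : p ∘ₗ p = p) :
    p.rangeRestrict ∘ₗ (LinearMap.range p).subtype = LinearMap.id := by
  ext ⟨_, y, rfl⟩
  exact DFunLike.congr_fun hp y

end Indecomposable

section LeftAlmostSplit

variable {R : Type u} [Ring R] {N E : Type u} [AddCommGroup N] [Module R N] [AddCommGroup E]
  [Module R E]

lemma exists_factor_epi {X Z : Type u} [AddCommGroup X] [Module R X] [AddCommGroup Z]
    [Module R Z] (p : E →ₗ[R] X) (hp : Function.Surjective p) (g : E →ₗ[R] Z)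
    (h : ∀ x, p x = 0 → g x = 0) : ∃ k : X →ₗ[R] Z, ∀ x, k (p x) = g x :=
  ⟨(LinearMap.ker p).liftQ g h ∘ₗ (p.quotKerEquivOfSurjective hp).symm.toLinearMap, fun x => by
    have : (p.quotKerEquivOfSurjective hp).symm (p x) = Submodule.Quotient.mk x := by
      rw [LinearEquiv.symm_apply_eq]; rfl
    exact congrArg ((LinearMap.ker p).liftQ g h) this⟩

lemma exists_factor_mono {X Z : Type u} [AddCommGroup X] [Module R X] [AddCommGroup Z]
    [Module R Z] (i : X →ₗ[R] Z) (hi : Function.Injective i) (g : E →ₗ[R] Z)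
    (h : ∀ x, g x ∈ LinearMap.range i) : ∃ k : E →ₗ[R] X, ∀ x, i (k x) = g x :=
  ⟨(LinearEquiv.ofInjective i hi).symm.toLinearMap ∘ₗ g.codRestrict _ h, fun x => by
    exact congrArg Subtype.val ((LinearEquiv.ofInjective i hi).apply_symm_apply ⟨g x, h x⟩)⟩

/-- `f` is not a split monomorphism. -/
def NotSplit (f : N →ₗ[R] E) : Prop := ∀ g : E →ₗ[R] N, g ∘ₗ f ≠ LinearMap.id

/-- `f` is left almost split among all modules. -/
def IsLeftAlmostSplit (f : N →ₗ[R] E) : Prop :=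
  NotSplit f ∧ ∀ (V : Type u) [AddCommGroup V] [Module R V] (h : N →ₗ[R] V), NotSplit h →
    ∃ k : E →ₗ[R] V, k ∘ₗ f = h

lemma IsLeftAlmostSplit.exists_minimal [IsArtinian R E] {f : N →ₗ[R] E}
    (hf : IsLeftAlmostSplit f) :
    ∃ (L : Submodule R E) (g : N →ₗ[R] L), IsLeftAlmostSplit g ∧
      ∀ θ : L →ₗ[R] L, θ ∘ₗ g = g → Function.Surjective θ := by
  obtain ⟨L, ⟨g, hg⟩, hmin⟩ := IsArtinian.set_has_minimal
    {L : Submodule R E | ∃ g : N →ₗ[R] L, IsLeftAlmostSplit g}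
    ⟨⊤, f.codRestrict ⊤ fun _ => trivial,
      fun g hg => hf.1 (g ∘ₗ LinearMap.id.codRestrict ⊤ fun _ => trivial) hg,
      fun V _ _ h hh => by
        obtain ⟨k, hk⟩ := hf.2 V h hh
        exact ⟨k ∘ₗ Submodule.subtype ⊤, hk⟩⟩
  refine ⟨L, g, hg, fun θ hθ => ?_⟩
  let L' : Submodule R E := (LinearMap.range θ).map L.subtype
  have hle : L' ≤ L := Submodule.map_subtype_le L _
  have hmem : ∀ x, (θ x : E) ∈ L' := fun x => ⟨θ x, ⟨x, rfl⟩, rfl⟩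
  let ψ : L →ₗ[R] L' := (L.subtype ∘ₗ θ).codRestrict L' hmem
  have hψ : ∀ x, (Submodule.inclusion hle) (ψ (g x)) = g x := fun x =>
    DFunLike.congr_fun hθ x
  have hL' : ∃ g : N →ₗ[R] L', IsLeftAlmostSplit g :=
    ⟨ψ ∘ₗ g, fun s hs => hg.1 (s ∘ₗ ψ) hs, fun V _ _ h hh => by
      obtain ⟨k, hk⟩ := hg.2 V h hh
      exact ⟨k ∘ₗ Submodule.inclusion hle, LinearMap.ext fun x =>
        (congrArg k (hψ x)).trans (DFunLike.congr_fun hk x)⟩⟩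
  intro x
  have hx : (x : E) ∈ L' := by
    rw [eq_of_le_of_not_lt hle (hmin L' hL')]
    exact x.2
  obtain ⟨y, ⟨z, rfl⟩, hy⟩ := hx
  exact ⟨z, Subtype.ext hy⟩

lemma IsLeftAlmostSplit.irreducible_component [IsNoetherian R E] {g : N →ₗ[R] E}
    (hg : IsLeftAlmostSplit g) (hmin : ∀ θ : E →ₗ[R] E, θ ∘ₗ g = g → Function.Surjective θ)
    (hN : IsIndecomposable R N) {p : E →ₗ[R] E} (hp : p ∘ₗ p = p)
    (hpi : Nontrivial (LinearMap.range p)) :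
    NotSplit (p.rangeRestrict ∘ₗ g) ∧
    (∀ s : LinearMap.range p →ₗ[R] N, (p.rangeRestrict ∘ₗ g) ∘ₗ s ≠ LinearMap.id) ∧
    ∀ (V : Type u) [AddCommGroup V] [Module R V] (a : N →ₗ[R] V)
      (b : V →ₗ[R] LinearMap.range p), b ∘ₗ a = p.rangeRestrict ∘ₗ g → NotSplit a →
      ∃ s : LinearMap.range p →ₗ[R] V, b ∘ₗ s = LinearMap.id := by
  have hns : NotSplit (p.rangeRestrict ∘ₗ g) := fun s hs => hg.1 (s ∘ₗ p.rangeRestrict) hs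
  refine ⟨hns, fun s hs => ?_, fun V _ _ a b hab ha => ?_⟩
  · rcases hN.2 (s ∘ₗ p.rangeRestrict ∘ₗ g) (LinearMap.ext fun x =>
      congrArg s (DFunLike.congr_fun hs (p.rangeRestrict (g x)))) with h | h
    · obtain ⟨x, hx⟩ := exists_ne (0 : LinearMap.range p)
      apply hx
      have h1 : ∀ y, p.rangeRestrict (g (s y)) = y := DFunLike.congr_fun hs
      have h2 : s (p.rangeRestrict (g (s x))) = 0 := DFunLike.congr_fun h (s x)
      rw [h1] at h2
      rw [← h1 x, h2, map_zero, map_zero]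
    · exact hns s h
  · obtain ⟨k, rfl⟩ := hg.2 V a ha
    have hpp : ∀ x : LinearMap.range p, p.rangeRestrict x = x :=
      DFunLike.congr_fun (rangeRestrict_comp_subtype hp)
    let θ : E →ₗ[R] E := LinearMap.id - p + (LinearMap.range p).subtype ∘ₗ b ∘ₗ k
    have hθ : θ ∘ₗ g = g := LinearMap.ext fun x => by
      have h1 : ((b (k (g x)) : LinearMap.range p) : E) = p (g x) :=
        congrArg Subtype.val (DFunLike.congr_fun hab x)
      simp [θ, h1]
    have hs := hmin θ hθ
    let e := LinearEquiv.ofBijective θ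
      ⟨IsNoetherian.injective_of_surjective_endomorphism θ hs, hs⟩
    have hpθ : ∀ y, p (θ y) = b (k y) := fun y => by
      have h1 : p (p y) = p y := DFunLike.congr_fun hp y
      have h2 : p (b (k y)) = b (k y) := congrArg Subtype.val (hpp (b (k y)))
      simp [θ, h1, h2]
    refine ⟨k ∘ₗ e.symm.toLinearMap ∘ₗ (LinearMap.range p).subtype, LinearMap.ext fun x => ?_⟩
    apply Subtype.ext
    refine (hpθ (e.symm x)).symm.trans ?_
    have : θ (e.symm x) = x := e.apply_symm_apply x
    rw [this]
    exact congrArg Subtype.val (hpp x)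

end LeftAlmostSplit

section Existence

variable {R : Type u} [Ring R] {N : Type u} [AddCommGroup N] [Module R N]

lemma isUnit_or_isUnit_of_isUnit_add {S : Type*} [Ring S] [IsLocalRing S] {a b : S}
    (h : IsUnit (a + b)) : IsUnit a ∨ IsUnit b := by
  obtain ⟨w, hw⟩ := h
  have h1 : (↑w⁻¹ * a) + (↑w⁻¹ * b) = 1 := by rw [← mul_add, ← hw, Units.inv_mul]
  refine (IsLocalRing.isUnit_or_isUnit_of_add_one h1).imp (fun h => ?_) fun h => ?_
  · exact (Units.isUnit_units_mul _ _).1 h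
  · exact (Units.isUnit_units_mul _ _).1 h

lemma exists_pushout {P X V : Type u} [AddCommGroup P] [Module R P] [AddCommGroup X]
    [Module R X] [AddCommGroup V] [Module R V] (f : N →ₗ[R] P) (hf : Function.Injective f)
    (q : P →ₗ[R] X) (hfq : LinearMap.range f = LinearMap.ker q) (h : N →ₗ[R] V) :
    ∃ (W : Type u) (_ : AddCommGroup W) (_ : Module R W) (i : V →ₗ[R] W) (j : P →ₗ[R] W)
      (p : W →ₗ[R] X), Function.Injective i ∧ (∀ x, i (h x) = j (f x)) ∧ (∀ v, p (i v) = 0) ∧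
      (∀ x, p (j x) = q x) ∧ ∀ w, p w = 0 → w ∈ LinearMap.range i := by
  have hqf : ∀ x, q (f x) = 0 := fun x => by
    have : f x ∈ LinearMap.ker q := hfq ▸ LinearMap.mem_range_self f x
    exact this
  let S := LinearMap.range (h.prod (-f))
  refine ⟨(V × P) ⧸ S, inferInstance, inferInstance, S.mkQ ∘ₗ LinearMap.inl R V P,
    S.mkQ ∘ₗ LinearMap.inr R V P, S.liftQ (q ∘ₗ LinearMap.snd R V P) ?_, ?_, ?_, ?_, ?_, ?_⟩
  · rintro _ ⟨x, rfl⟩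
    simp [hqf]
  · rw [injective_iff_map_eq_zero]
    intro v hv
    obtain ⟨x, hx⟩ := (Submodule.Quotient.mk_eq_zero S).1 hv
    have h1 : h x = v := congrArg Prod.fst hx
    have h2 : -f x = 0 := congrArg Prod.snd hx
    rw [neg_eq_zero, map_eq_zero_iff f hf] at h2
    rw [← h1, h2, map_zero]
  · intro x
    refine (Submodule.Quotient.eq S).2 ⟨x, ?_⟩
    simp
  · intro v
    simp
  · intro x
    simp
  · intro w
    obtain ⟨⟨v, x⟩, rfl⟩ := S.mkQ_surjective w
    intro hw
    have hx : x ∈ LinearMap.range f := by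
      rw [hfq]
      simpa using hw
    obtain ⟨y, rfl⟩ := hx
    refine ⟨v + h y, (Submodule.Quotient.eq S).2 ⟨y, ?_⟩⟩
    simp

/-- An extension whose cokernel term has the lifting property of an almost split sequence, and
whose first term has a local endomorphism ring, is left almost split. -/
lemma isLeftAlmostSplit_of_lifting {P X : Type u} [AddCommGroup P] [Module R P]
    [AddCommGroup X] [Module R X] [IsLocalRing (Module.End R N)]
    (f : N →ₗ[R] P) (hf : Function.Injective f) (q : P →ₗ[R] X)
    (hfq : LinearMap.range f = LinearMap.ker q) (hns : NotSplit f)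
    (hlift : ∀ (W : Type u) [AddCommGroup W] [Module R W] (p : W →ₗ[R] X),
      (∃ s, p ∘ₗ s = LinearMap.id) ∨ ∃ t : W →ₗ[R] P, q ∘ₗ t = p) :
    IsLeftAlmostSplit f := by
  have hqf : ∀ x, q (f x) = 0 := fun x => by
    have : f x ∈ LinearMap.ker q := hfq ▸ LinearMap.mem_range_self f x
    exact this
  have hsplit : ∀ {V : Type u} [AddCommGroup V] [Module R V] (g : N →ₗ[R] V) (b : V →ₗ[R] N),
      NotSplit g → ¬ IsUnit (show Module.End R N from b ∘ₗ g) := by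
    intro V _ _ g b hg hu
    obtain ⟨c, hc⟩ := hu.exists_left_inv
    exact hg (c ∘ₗ b) hc
  refine ⟨hns, fun V _ _ h hh => ?_⟩
  obtain ⟨W, _, _, i, j, p, hi, hij, hpi, hpj, hp⟩ := exists_pushout f hf q hfq h
  rcases hlift W p with ⟨s, hs⟩ | ⟨t, ht⟩
  · have hps : ∀ x, p (s x) = x := DFunLike.congr_fun hs
    obtain ⟨k, hk⟩ := exists_factor_mono i hi (j - s ∘ₗ q) fun x => hp _ (by simp [hpj, hps])
    refine ⟨k, LinearMap.ext fun x => hi ?_⟩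
    rw [LinearMap.comp_apply, hk, hij]
    simp [hqf]
  · have hqt : ∀ w, q (t w) = p w := DFunLike.congr_fun ht
    obtain ⟨r, hr⟩ := exists_factor_mono f hf (LinearMap.id - t ∘ₗ j) fun x => by
      rw [hfq]; simp [hqt, hpj]
    obtain ⟨a, ha⟩ := exists_factor_mono f hf (t ∘ₗ i) fun x => by
      rw [hfq]; simp [hqt, hpi]
    have hsum : (show Module.End R N from r ∘ₗ f) + (show Module.End R N from a ∘ₗ h) = 1 := by
      refine LinearMap.ext fun x => hf ?_
      change f (r (f x) + a (h x)) = f x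
      rw [map_add, hr, ha]
      simp [hij]
    rcases IsLocalRing.isUnit_or_isUnit_of_add_one hsum with hu | hu
    · exact absurd hu (hsplit f r hns)
    · exact absurd hu (hsplit h a hh)

section Pullback

variable {V Y Z : Type u} [AddCommGroup V] [Module R V] [AddCommGroup Y] [Module R Y]
  [AddCommGroup Z] [Module R Z]

/-- The pullback of `u` and `d`. -/
abbrev Pullback (u : V →ₗ[R] Z) (d : Y →ₗ[R] Z) : Submodule R (V × Y) :=
  LinearMap.ker (u ∘ₗ LinearMap.fst R V Y - d ∘ₗ LinearMap.snd R V Y)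

variable {u : V →ₗ[R] Z} {d : Y →ₗ[R] Z} {f₀ : N →ₗ[R] Y}

lemma Pullback.mem_iff {x : V × Y} : x ∈ Pullback u d ↔ u x.1 = d x.2 := by
  simp [Pullback, sub_eq_zero]

variable (u) in
/-- The map from the kernel of `d` to the pullback. -/
def Pullback.ofKer (hd : LinearMap.range f₀ = LinearMap.ker d) : N →ₗ[R] Pullback u d :=
  (LinearMap.inr R V Y ∘ₗ f₀).codRestrict _ fun x => by
    have h : d (f₀ x) = 0 := by
      have : f₀ x ∈ LinearMap.ker d := hd ▸ LinearMap.mem_range_self f₀ x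
      exact this
    simp [h]

variable (u d) in
/-- The first projection of the pullback. -/
def Pullback.fst : Pullback u d →ₗ[R] V := LinearMap.fst R V Y ∘ₗ (Pullback u d).subtype

variable (u d) in
/-- The second projection of the pullback. -/
def Pullback.snd : Pullback u d →ₗ[R] Y := LinearMap.snd R V Y ∘ₗ (Pullback u d).subtype

lemma Pullback.condition (x : Pullback u d) : u (Pullback.fst u d x) = d (Pullback.snd u d x) :=
  Pullback.mem_iff.1 x.2

lemma Pullback.ofKer_injective (hd : LinearMap.range f₀ = LinearMap.ker d)
    (hf₀ : Function.Injective f₀) : Function.Injective (Pullback.ofKer u hd) :=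
  fun _ _ h => hf₀ (congrArg (Pullback.snd u d) h)

lemma Pullback.range_ofKer (hd : LinearMap.range f₀ = LinearMap.ker d) :
    LinearMap.range (Pullback.ofKer u hd) = LinearMap.ker (Pullback.fst u d) := by
  ext x
  constructor
  · rintro ⟨y, rfl⟩
    rfl
  · intro hx
    have h : Pullback.snd u d x ∈ LinearMap.range f₀ := by
      rw [hd, LinearMap.mem_ker, ← Pullback.condition, LinearMap.mem_ker.1 hx, map_zero]
    obtain ⟨y, hy⟩ := h
    exact ⟨y, Subtype.ext (Prod.ext (LinearMap.mem_ker.1 hx).symm hy)⟩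

lemma Pullback.fst_surjective (hu : ∀ v, u v ∈ LinearMap.range d) :
    Function.Surjective (Pullback.fst u d) := fun v => by
  obtain ⟨y, hy⟩ := hu v
  exact ⟨⟨(v, y), Pullback.mem_iff.2 hy.symm⟩, rfl⟩

lemma Pullback.notSplit_ofKer (hd : LinearMap.range f₀ = LinearMap.ker d)
    (hu : ∀ v, u v ∈ LinearMap.range d) (hno : ¬ ∃ w : V →ₗ[R] Y, u = d ∘ₗ w) :
    NotSplit (Pullback.ofKer u hd) := by
  intro r hr
  have hrf : ∀ x, r (Pullback.ofKer u hd x) = x := DFunLike.congr_fun hr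
  obtain ⟨k, hk⟩ := exists_factor_epi (Pullback.fst u d) (Pullback.fst_surjective hu)
    (Pullback.snd u d - f₀ ∘ₗ r) fun x hx => by
      have : x ∈ LinearMap.range (Pullback.ofKer u hd) := by
        rw [Pullback.range_ofKer]; exact hx
      obtain ⟨y, rfl⟩ := this
      rw [LinearMap.sub_apply, LinearMap.comp_apply, hrf, sub_eq_zero]
      rfl
  refine hno ⟨k, LinearMap.ext fun v => ?_⟩
  obtain ⟨x, rfl⟩ := Pullback.fst_surjective hu v
  have h : d (f₀ (r x)) = 0 := by
    have : f₀ (r x) ∈ LinearMap.ker d := hd ▸ LinearMap.mem_range_self f₀ _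
    exact this
  rw [LinearMap.comp_apply, hk, Pullback.condition, LinearMap.sub_apply, map_sub,
    LinearMap.comp_apply, h, sub_zero]

lemma Pullback.exists_leftAlmostSplit [IsLocalRing (Module.End R N)]
    [IsNoetherian R V] [IsNoetherian R Y]
    (hd : LinearMap.range f₀ = LinearMap.ker d) (hf₀ : Function.Injective f₀)
    (hu : ∀ v, u v ∈ LinearMap.range d) (hno : ¬ ∃ w : V →ₗ[R] Y, u = d ∘ₗ w)
    (hlift : ∀ (W : Type u) [AddCommGroup W] [Module R W] (p : W →ₗ[R] V),
      (∃ s, p ∘ₗ s = LinearMap.id) ∨ ∃ w : W →ₗ[R] Y, u ∘ₗ p = d ∘ₗ w) :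
    ∃ (P : Type u) (_ : AddCommGroup P) (_ : Module R P) (f : N →ₗ[R] P),
      Module.Finite R P ∧ IsLeftAlmostSplit f := by
  refine ⟨Pullback u d, inferInstance, inferInstance, Pullback.ofKer u hd, inferInstance, ?_⟩
  refine isLeftAlmostSplit_of_lifting _ (Pullback.ofKer_injective hd hf₀) (Pullback.fst u d)
    (Pullback.range_ofKer hd) (Pullback.notSplit_ofKer hd hu hno) fun W _ _ q => ?_
  refine (hlift W q).imp_right fun ⟨w, hw⟩ => ?_
  exact ⟨(q.prod w).codRestrict (Pullback u d) fun x =>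
    Pullback.mem_iff.2 (DFunLike.congr_fun hw x), LinearMap.ext fun x => rfl⟩

lemma IsLeftAlmostSplit.exists_hom_ne_zero {L : Type u} [AddCommGroup L] [Module R L]
    {g : N →ₗ[R] L} (hg : IsLeftAlmostSplit g)
    (hd : LinearMap.range f₀ = LinearMap.ker d) (hf₀ : Function.Injective f₀)
    (hu : ∀ v, u v ∈ LinearMap.range d) (hno : ¬ ∃ w : V →ₗ[R] Y, u = d ∘ₗ w) :
    ∃ ψ : L →ₗ[R] V, ψ ≠ 0 := by
  obtain ⟨k, hk⟩ := hg.2 _ (Pullback.ofKer u hd) (Pullback.notSplit_ofKer hd hu hno)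
  refine ⟨Pullback.fst u d ∘ₗ k, fun h0 => ?_⟩
  obtain ⟨s, hs⟩ := exists_factor_mono (Pullback.ofKer u hd)
    (Pullback.ofKer_injective hd hf₀) k fun x => by
      rw [Pullback.range_ofKer]; exact DFunLike.congr_fun h0 x
  exact hg.1 s (LinearMap.ext fun x => Pullback.ofKer_injective hd hf₀
    ((hs (g x)).trans (DFunLike.congr_fun hk x)))

end Pullback

variable {K E I : Type u} [CommRing K] [Algebra K R] [AddCommGroup E] [Module K E]
  [AddCommGroup I] [Module R I] [Module K I] [IsScalarTower K R I] {ε : I →ₗ[K] E} {n m : ℕ}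
  {d : (Fin n → I) →ₗ[R] (Fin m → I)} {ρ : Fin n → Fin m → R}

lemma exists_functional_nonunit (hE : IsDualizing K E) (X : Type u) [AddCommGroup X]
    [Module R X] [Module K X] [IsScalarTower K R X] [IsLocalRing (Module.End R X)] :
    ∃ c : (X →ₗ[R] X) →ₗ[K] E, c LinearMap.id ≠ 0 ∧
      ∀ α : Module.End R X, ¬ IsUnit α → c α = 0 := by
  let S : Submodule K (X →ₗ[R] X) :=
    { carrier := {α | ¬ IsUnit (show Module.End R X from α)}
      add_mem' := fun ha hb h => (isUnit_or_isUnit_of_isUnit_add h).elim ha hb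
      zero_mem' := fun h => not_isUnit_zero (M₀ := Module.End R X) h
      smul_mem' := fun k α hα h => by
        rw [Module.End.isUnit_iff] at h
        refine hα ((Module.End.isUnit_iff _).2 ⟨fun x y hxy => h.1 ?_, fun y => ?_⟩)
        · exact congrArg (k • ·) hxy
        · obtain ⟨x, rfl⟩ := h.2 y
          exact ⟨k • x, (α.map_smul_of_tower k x)⟩ }
  obtain ⟨f, hf⟩ := hE.exists_apply_ne (x := S.mkQ LinearMap.id) fun h =>
    ((Submodule.Quotient.mk_eq_zero S).1 h) (isUnit_one (M := Module.End R X))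
  refine ⟨f ∘ₗ S.mkQ, hf, fun α hα => ?_⟩
  have : S.mkQ α = 0 := (Submodule.Quotient.mk_eq_zero S).2 hα
  rw [LinearMap.comp_apply, this, map_zero]

lemma IsRegularDual.exists_almost_liftable (hI : IsRegularDual K R E I ε)
    (hE : IsDualizing K E) (hρ : ∀ y k, ε (d y k) = ∑ i, ε (ρ i k • y i))
    (X : Type u) [AddCommGroup X] [Module R X] [IsLocalRing (Module.End R X)]
    (i : X →ₗ[R] Transpose ρ) (π : Transpose ρ →ₗ[R] X) (hπ : π ∘ₗ i = LinearMap.id)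
    (hX : ∀ (β : Transpose ρ →ₗ[R] R) (v : R →ₗ[R] X),
      ¬ IsUnit (show Module.End R X from v ∘ₗ β ∘ₗ i)) :
    ∃ u : X →ₗ[R] (Fin m → I), (∀ v, u v ∈ LinearMap.range d) ∧
      (¬ ∃ w : X →ₗ[R] (Fin n → I), u = d ∘ₗ w) ∧
      ∀ (W : Type u) [AddCommGroup W] [Module R W] (p : W →ₗ[R] X),
        (∃ s, p ∘ₗ s = LinearMap.id) ∨ ∃ w : W →ₗ[R] (Fin n → I), u ∘ₗ p = d ∘ₗ w := by
  let _ := Module.compHom X (algebraMap K R)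
  have := isScalarTower_compHom (K := K) (R := R) X
  obtain ⟨c, hc1, hc⟩ := exists_functional_nonunit (R := R) hE X
  let φ : (Transpose ρ →ₗ[R] X) →ₗ[K] E := c ∘ₗ
    { toFun := fun α => α ∘ₗ i
      map_add' := fun _ _ => rfl
      map_smul' := fun _ _ => rfl }
  obtain ⟨u, hu, hud⟩ := hI.exists_of_functional hρ hE φ fun β v => hc _ (hX β v)
  refine ⟨u, hud, ?_, fun W _ _ p => or_iff_not_imp_left.2 fun hp => ?_⟩
  · rintro ⟨w, rfl⟩
    refine hc1 ?_
    rw [← hπ, ← pairing_eq_zero hρ w π, hu]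
    rfl
  · refine hI.exists_lift hρ hE _ fun θ => ?_
    rw [pairing_comp, hu]
    refine hc _ fun h => hp ?_
    obtain ⟨b, hb⟩ := h.exists_right_inv
    exact ⟨θ ∘ₗ i ∘ₗ b, hb⟩

/-- An indecomposable module with a copresentation by `d` admits a minimal left almost split map
if some map into the image of `d` does not lift along `d`. -/
lemma IsRegularDual.exists_minimal_leftAlmostSplit [IsArtinianRing R] [Module.Finite R I]
    (hI : IsRegularDual K R E I ε) (hE : IsDualizing K E) [Module.Finite R N]
    (hN : IsIndecomposable R N) (f₀ : N →ₗ[R] (Fin n → I)) (hf₀ : Function.Injective f₀)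
    (hd : LinearMap.range f₀ = LinearMap.ker d) {V : Type u} [AddCommGroup V] [Module R V]
    (u₀ : V →ₗ[R] (Fin m → I)) (hu₀ : ∀ v, u₀ v ∈ LinearMap.range d)
    (hno : ¬ ∃ w : V →ₗ[R] (Fin n → I), u₀ = d ∘ₗ w) :
    ∃ (L : Type u) (_ : AddCommGroup L) (_ : Module R L) (g : N →ₗ[R] L),
      Module.Finite R L ∧ IsLeftAlmostSplit g ∧
      ∀ θ : L →ₗ[R] L, θ ∘ₗ g = g → Function.Surjective θ := by
  obtain ⟨ρ, hρ⟩ := hI.exists_matrix d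
  obtain ⟨θ, hθ⟩ : ∃ θ, pairing ε ρ u₀ θ ≠ 0 := by
    by_contra! h
    exact hno (hI.exists_lift hρ hE u₀ h)
  obtain ⟨κ, _, p, hp, hpi, hsum⟩ := exists_sum_indecomposable R (Transpose ρ)
  obtain ⟨j, hj⟩ : ∃ j, pairing ε ρ u₀ (θ ∘ₗ p j) ≠ 0 := by
    by_contra! h
    refine hθ ?_
    have : θ = ∑ j, θ ∘ₗ p j := by
      refine LinearMap.ext fun x => ?_
      rw [LinearMap.sum_apply]
      simp only [LinearMap.comp_apply]
      rw [← map_sum, ← LinearMap.sum_apply, hsum, LinearMap.id_apply]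
    rw [this, pairing_sum]
    exact Finset.sum_eq_zero fun j _ => h j
  have := (hpi j).isLocalRing
  have := hN.isLocalRing
  have hfix := rangeRestrict_comp_subtype (hp j)
  obtain ⟨u, hu, hunl, hlift⟩ := hI.exists_almost_liftable hE hρ (LinearMap.range (p j))
    (LinearMap.range (p j)).subtype (p j).rangeRestrict hfix fun β v h => by
      obtain ⟨b, hb⟩ := h.exists_left_inv
      let a : R →ₗ[R] V := θ ∘ₗ (LinearMap.range (p j)).subtype ∘ₗ b ∘ₗ v
      have ha : θ ∘ₗ p j = a ∘ₗ β ∘ₗ p j := by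
        refine LinearMap.ext fun x => ?_
        have := DFunLike.congr_fun hb ((p j).rangeRestrict x)
        exact congrArg (fun z : LinearMap.range (p j) => θ z) this.symm
      obtain ⟨y, hy⟩ := hu₀ (a 1)
      have ha' : u₀ ∘ₗ a = d ∘ₗ LinearMap.toSpanSingleton R _ y :=
        LinearMap.ext_ring (by simp [hy])
      refine hj ?_
      rw [ha, ← pairing_comp, ha', pairing_eq_zero hρ]
  obtain ⟨P, _, _, f, _, hf⟩ := Pullback.exists_leftAlmostSplit hd hf₀ hu hunl hlift
  obtain ⟨L, g, hg, hmin⟩ := hf.exists_minimal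
  exact ⟨L, inferInstance, inferInstance, g, inferInstance, hg, hmin⟩

end Existence

section Component

variable {A : Type u} [Ring A]

/-- A module in a component as in the main theorem has no nonzero map to the regular module. -/
lemma hom_regular_eq_zero [IsArtinianRing Aᵐᵒᵖ] {C : Set (Modc A)}
    (hnoproj : ∀ X ∈ C, ¬ Module.Projective Aᵐᵒᵖ X) (hne : ¬ HasExtShortPath C)
    {M : Modc A} (hM : InAdd C M) (hfaith : annM M = {0}) {X : Modc A} (hX : X ∈ C)
    (f : X →ₗ[Aᵐᵒᵖ] Aᵐᵒᵖ) : f = 0 := by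
  by_contra hf
  obtain ⟨κ, _, p, hp, hpi, hsum⟩ := exists_sum_indecomposable Aᵐᵒᵖ Aᵐᵒᵖ
  obtain ⟨i, hi⟩ : ∃ i, (p i).rangeRestrict ∘ₗ f ≠ 0 := by
    by_contra! h
    refine hf (LinearMap.ext fun x => ?_)
    have h1 : ∑ i, p i (f x) = f x := by
      rw [← LinearMap.sum_apply, hsum, LinearMap.id_apply]
    rw [← h1]
    exact Finset.sum_eq_zero fun i _ => congrArg Subtype.val (DFunLike.congr_fun (h i) x)
  have hproj : Module.Projective Aᵐᵒᵖ (LinearMap.range (p i)) :=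
    Module.Projective.of_split (LinearMap.range (p i)).subtype (p i).rangeRestrict
      (rangeRestrict_comp_subtype (hp i))
  have := (hpi i).1
  obtain ⟨⟨b, hb⟩, hb0⟩ := exists_ne (0 : LinearMap.range (p i))
  have hb1 : b ≠ 0 := fun h => hb0 (Subtype.ext h)
  obtain ⟨x, hx⟩ : ∃ x : M, b • x ≠ 0 := by
    by_contra! h
    have : b.unop ∈ annM M := h
    rw [hfaith] at this
    exact hb1 (MulOpposite.unop_injective this)
  obtain ⟨k, F, hF, ⟨e⟩⟩ := hM
  obtain ⟨j, hj⟩ : ∃ j, e (b • x) j ≠ 0 := by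
    by_contra! h
    exact hx ((map_eq_zero_iff e e.injective).1 (funext h))
  let g : LinearMap.range (p i) →ₗ[Aᵐᵒᵖ] F j :=
    LinearMap.proj j ∘ₗ e.toLinearMap ∘ₗ LinearMap.toSpanSingleton Aᵐᵒᵖ M x ∘ₗ
      (LinearMap.range (p i)).subtype
  have hg : g ≠ 0 := fun h => hj (DFunLike.congr_fun h ⟨b, hb⟩)
  refine hne ⟨X, ModuleCat.of Aᵐᵒᵖ (LinearMap.range (p i)), F j, hX, hF j,
    fun h => hnoproj _ h hproj, (inferInstance : Module.Finite Aᵐᵒᵖ (LinearMap.range (p i))),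
    hpi i, ⟨(p i).rangeRestrict ∘ₗ f, hi, fun h => hnoproj X hX ?_⟩,
    ⟨g, hg, fun h => hnoproj _ (hF j) ?_⟩⟩
  · exact Module.Projective.of_equiv (LinearEquiv.ofBijective ((p i).rangeRestrict ∘ₗ f) h).symm
  · exact Module.Projective.of_equiv (LinearEquiv.ofBijective g h)

/-- The image of an indecomposable projection of the target of a minimal left almost split map
is a neighbor of its source. -/
lemma IsLeftAlmostSplit.neighbor {N : Modc A} {L : Type u} [AddCommGroup L] [Module Aᵐᵒᵖ L]
    [IsNoetherian Aᵐᵒᵖ L] {g : N →ₗ[Aᵐᵒᵖ] L} (hg : IsLeftAlmostSplit g)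
    (hmin : ∀ θ : L →ₗ[Aᵐᵒᵖ] L, θ ∘ₗ g = g → Function.Surjective θ)
    (hfin : FinGen N) (hN : Indec N) {p : L →ₗ[Aᵐᵒᵖ] L} (hp : p ∘ₗ p = p)
    (hpi : IsIndecomposable Aᵐᵒᵖ (LinearMap.range p)) :
    Neighbor N (ModuleCat.of Aᵐᵒᵖ (LinearMap.range p)) := by
  obtain ⟨h1, h2, h3⟩ := hg.irreducible_component hmin hN hp hpi.1
  refine ⟨hfin, (inferInstance : Module.Finite Aᵐᵒᵖ (LinearMap.range p)), hN, hpi,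
    Or.inr (Or.inl ⟨p.rangeRestrict ∘ₗ g, fun ⟨s, hs⟩ => h1 s hs, fun ⟨s, hs⟩ => h2 s hs,
      fun V a b hab => or_iff_not_imp_right.2 fun ha => h3 V a b hab fun s hs => ha ⟨s, hs⟩⟩)⟩

end Component

/-- Baer's criterion for the image of a map `d` out of an injective module: it suffices to lift
along `d` the maps from left ideals into the image. -/
lemma injective_range_of_lift {R : Type u} [Ring R] {Y Z : Type u} [AddCommGroup Y] [Module R Y]
    [AddCommGroup Z] [Module R Z] (hY : Module.Injective R Y) (d : Y →ₗ[R] Z)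
    (h : ∀ (J : Ideal R) (u : J →ₗ[R] Z), (∀ x, u x ∈ LinearMap.range d) →
      ∃ w : J →ₗ[R] Y, u = d ∘ₗ w) : Module.Injective R (LinearMap.range d) := by
  refine Module.Baer.injective fun J g => ?_
  obtain ⟨w, hw⟩ := h J ((LinearMap.range d).subtype ∘ₗ g) fun x => (g x).2
  obtain ⟨w', hw'⟩ := hY.out J.subtype Subtype.val_injective w
  refine ⟨d.rangeRestrict ∘ₗ w', fun x hx => Subtype.ext ?_⟩
  change d (w' x) = g ⟨x, hx⟩
  have h1 := hw' ⟨x, hx⟩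
  have h2 := DFunLike.congr_fun hw ⟨x, hx⟩
  exact (congrArg d h1).trans h2.symm

end ARComponent

/-- For a component `C` without projective modules and
without external short paths, admitting a faithful module in `add C`, every
module in `C` has injective dimension at most 1. -/
theorem id_le_one_of_component
    (K : Type u) [CommRing K] [IsArtinianRing K]
    (A : Type u) [Ring A] [Algebra K A] [Module.Finite K A]
    (C : Set (Modc A)) (hC : IsARComponent C)
    (hnoproj : ∀ X ∈ C, ¬ Module.Projective Aᵐᵒᵖ X)
    (hne : ¬ HasExtShortPath C)
    (M : Modc A) (hM : InAdd C M) (hfaith : annM M = {0}) :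
    ∀ N ∈ C, IdLE1 N := by
  intro N hNC
  obtain ⟨hNfin, hN⟩ := hC.2.1 N hNC
  have : Module.Finite Aᵐᵒᵖ N := hNfin
  have : Module.Finite K Aᵐᵒᵖ :=
    Module.Finite.equiv (MulOpposite.opLinearEquiv K : A ≃ₗ[K] Aᵐᵒᵖ)
  have : IsArtinianRing Aᵐᵒᵖ := IsArtinianRing.of_finite K Aᵐᵒᵖ
  obtain ⟨E, _, _, hE⟩ := ARComponent.exists_isDualizing K
  obtain ⟨ε, hI⟩ := hE.exists_isRegularDual (R := Aᵐᵒᵖ)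
  have : Module.Finite Aᵐᵒᵖ (ARComponent.RegularDual K Aᵐᵒᵖ E) := hE.finite_regularDual
  have hinj : Module.Injective Aᵐᵒᵖ (ARComponent.RegularDual K Aᵐᵒᵖ E) := hI.injective hE
  obtain ⟨n, f₀, hf₀⟩ := hI.exists_embedding hE N
  obtain ⟨m, e, he⟩ := hI.exists_embedding hE
    ((Fin n → ARComponent.RegularDual K Aᵐᵒᵖ E) ⧸ LinearMap.range f₀)
  let d := e ∘ₗ (LinearMap.range f₀).mkQ
  have hd : LinearMap.range f₀ = LinearMap.ker d := by
    rw [LinearMap.ker_comp, LinearMap.ker_eq_bot.2 he]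
    exact ((LinearMap.range f₀).ker_mkQ).symm
  have hinj₀ : Module.Injective Aᵐᵒᵖ (Fin n → ARComponent.RegularDual K Aᵐᵒᵖ E) :=
    Module.Injective.pi _ _
  refine ⟨ModuleCat.of Aᵐᵒᵖ (Fin n → ARComponent.RegularDual K Aᵐᵒᵖ E),
    ModuleCat.of Aᵐᵒᵖ (LinearMap.range d), f₀, d.rangeRestrict, hinj₀,
    ARComponent.injective_range_of_lift hinj₀ d fun J u hu => ?_, hf₀,
    d.surjective_rangeRestrict, by rw [LinearMap.ker_rangeRestrict, hd]⟩
  by_contra hno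
  obtain ⟨L, _, _, g, _, hg, hmin⟩ := hI.exists_minimal_leftAlmostSplit hE hN f₀ hf₀ hd u hu hno
  obtain ⟨ψ, hψ⟩ := hg.exists_hom_ne_zero hd hf₀ hu hno
  obtain ⟨κ, _, p, hp, hpi, hsum⟩ := ARComponent.exists_sum_indecomposable Aᵐᵒᵖ L
  refine hψ (LinearMap.ext fun x => ?_)
  have h1 : ∑ i, p i x = x := by
    rw [← LinearMap.sum_apply, hsum, LinearMap.id_apply]
  rw [← h1, map_sum]
  refine Finset.sum_eq_zero fun i _ => ?_
  have hmem : ModuleCat.of Aᵐᵒᵖ (LinearMap.range (p i)) ∈ C :=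
    hC.2.2.1 N hNC _ (hg.neighbor hmin hNfin hN (hp i) (hpi i))
  have h0 := ARComponent.hom_regular_eq_zero hnoproj hne hM hfaith hmem
    (J.subtype ∘ₗ ψ ∘ₗ (LinearMap.range (p i)).subtype)
  have h2 := DFunLike.congr_fun h0 (⟨p i x, x, rfl⟩ : LinearMap.range (p i))
  exact Subtype.ext h2
end

section
/- Let A be an artin algebra and C a faithful regular component of Γ_A without external short paths. Then every indecomposable module N in C satisfies pd_A N ≤ 1 and id_A N ≤ 1, and gldim A ≤ 2; in particular A is a quasi-tilted algebra. -/
universe u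

variable {A : Type u} [Ring A]

section InjectiveHull

variable {R : Type u} [Ring R]

theorem Module.Injective.of_retract {M N : Type u} [AddCommGroup M] [Module R M]
    [AddCommGroup N] [Module R N] [Module.Injective R M] (i : N →ₗ[R] M) (r : M →ₗ[R] N)
    (h : r ∘ₗ i = LinearMap.id) : Module.Injective R N where
  out X Y _ _ _ _ f hf g := by
    obtain ⟨k, hk⟩ := Module.Injective.out f hf (i ∘ₗ g)
    exact ⟨r ∘ₗ k, fun x ↦ by simpa [hk] using LinearMap.congr_fun h (g x)⟩

/-- Every submodule of an injective module has an injective essential extension inside it. -/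
theorem exists_essential_injective_submodule {Q : Type u} [AddCommGroup Q] [Module R Q]
    [Module.Injective R Q] (Y : Submodule R Q) :
    ∃ E : Submodule R Q, Y ≤ E ∧ Module.Injective R E ∧ ∀ V ≤ E, V ⊓ Y = ⊥ → V = ⊥ := by
  obtain ⟨E, hYE, hE⟩ := zorn_le_nonempty₀ {E : Submodule R Q | ∀ V ≤ E, V ⊓ Y = ⊥ → V = ⊥}
    (by
      intro c hc hchain y hy
      refine ⟨sSup c, fun V hV hVY ↦ ?_, fun z hz ↦ le_sSup hz⟩
      rw [Submodule.eq_bot_iff]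
      intro x hx
      obtain ⟨z, hz, hxz⟩ := (Submodule.mem_sSup_of_directed ⟨y, hy⟩ hchain.directedOn).1 (hV hx)
      have hspan : Submodule.span R {x} ≤ V := by simpa using hx
      have := hc hz (Submodule.span R {x}) (by simpa using hxz)
        (le_bot_iff.1 ((inf_le_inf_right Y hspan).trans hVY.le))
      simpa using this)
    Y (fun V hV h ↦ by rwa [inf_eq_left.2 hV] at h)
  obtain ⟨Z, -, hZ⟩ := zorn_le_nonempty₀ {Z : Submodule R Q | Z ⊓ E = ⊥}
    (by
      intro c hc hchain y hy
      refine ⟨sSup c, ?_, fun z hz ↦ le_sSup hz⟩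
      rw [Set.mem_ofPred_eq, Submodule.eq_bot_iff]
      rintro x ⟨hx, hxE⟩
      obtain ⟨z, hz, hxz⟩ := (Submodule.mem_sSup_of_directed ⟨y, hy⟩ hchain.directedOn).1 hx
      exact (Submodule.eq_bot_iff _).1 (hc hz) x ⟨hxz, hxE⟩)
    ⊥ (by simp)
  obtain ⟨g, hg⟩ := Module.Injective.out (Z.mkQ ∘ₗ E.subtype) (by
    rw [← LinearMap.ker_eq_bot, Submodule.eq_bot_iff]
    intro x hx
    have hxZ : (x : Q) ∈ Z := by simpa using hx
    exact Subtype.ext ((Submodule.eq_bot_iff _).1 hZ.prop x ⟨hxZ, x.2⟩)) E.subtype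
  set f : Q →ₗ[R] Q := g ∘ₗ Z.mkQ with hf
  have hfE : ∀ x ∈ E, f x = x := fun x hx ↦ hg ⟨x, hx⟩
  have hfZ : ∀ x ∈ Z, f x = 0 := fun x hx ↦ by
    simp [hf, (Submodule.Quotient.mk_eq_zero Z).2 hx]
  have hEf : E ≤ LinearMap.range f := fun x hx ↦ ⟨x, hfE x hx⟩
  have hrange : LinearMap.range f ≤ E := by
    refine hE.le_of_ge (fun V hV hVY ↦ ?_) hEf
    have hVE : V ⊓ E = ⊥ := hE.prop _ inf_le_right
      (le_bot_iff.1 ((inf_le_inf_right Y inf_le_left).trans hVY.le))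
    have hcomap : V.comap f ≤ Z := hZ.le_of_ge (by
      rw [Set.mem_ofPred_eq, Submodule.eq_bot_iff]
      rintro x ⟨hx, hxE⟩
      rw [SetLike.mem_coe, Submodule.mem_comap, hfE x hxE] at hx
      exact (Submodule.eq_bot_iff _).1 hVE x ⟨hx, hxE⟩)
      (fun x hx ↦ by simp [hfZ x hx])
    rw [Submodule.eq_bot_iff]
    intro x hx
    obtain ⟨y, rfl⟩ := hV hx
    exact hfZ y (hcomap hx)
  refine ⟨E, hYE, ?_, hE.prop⟩
  exact Module.Injective.of_retract E.subtype (f.codRestrict E fun x ↦ hrange ⟨x, rfl⟩)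
    (LinearMap.ext fun x ↦ Subtype.ext (hfE x x.2))

/-- Essential extensions of finitely generated modules over an artin algebra are finitely
generated. -/
theorem isNoetherian_of_essential (K : Type u) [CommRing K] [IsArtinianRing K] [Algebra K R]
    [Module.Finite K R] {E : Type u} [AddCommGroup E] [Module R E] [Module K E]
    [IsScalarTower K R E] (Y : Submodule R E) [IsNoetherian K Y]
    (hY : ∀ V : Submodule R E, V ⊓ Y = ⊥ → V = ⊥) : IsNoetherian K E := by
  have : IsArtinianRing R := IsArtinianRing.of_finite K R
  have : IsNoetherian K R := inferInstance
  set J := Ring.jacobson R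
  have hss : ∀ W : Submodule R E, (∀ a ∈ J, ∀ w ∈ W, a • w = 0) → W ≤ Y := by
    intro W hW
    have htors : Module.IsTorsionBySet R W J := fun w a ↦ Subtype.ext (hW a a.2 w w.2)
    have : IsSemisimpleModule R W := by
      let _ := htors.module
      exact (htors.semilinearMap.isSemisimpleModule_iff_of_bijective Function.bijective_id).2
        inferInstance
    obtain ⟨V, hV⟩ := exists_isCompl (Y.comap W.subtype)
    have hVbot : V.map W.subtype = ⊥ := hY _ (by
      rw [Submodule.eq_bot_iff]
      rintro x ⟨⟨v, hv, rfl⟩, hx⟩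
      simpa using hV.disjoint.le_bot (show v ∈ _ ⊓ V from ⟨hx, hv⟩))
    have hVbot' : V = ⊥ := by
      exact Submodule.map_injective_of_injective W.subtype_injective (by simpa using hVbot)
    have := hV.sup_eq_top
    rw [hVbot', sup_bot_eq] at this
    exact fun w hw ↦ (this.ge (Submodule.mem_top (x := ⟨w, hw⟩)) :)
  have key : ∀ (n : ℕ) (W : Submodule R E), (∀ a ∈ J ^ n, ∀ w ∈ W, a • w = 0) →
      IsNoetherian K W := by
    intro n
    induction n with
    | zero =>
      intro W hW
      have : W = ⊥ := (Submodule.eq_bot_iff _).2 fun w hw ↦ by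
        simpa using hW 1 (by rw [J.pow_zero, Ideal.one_eq_top]; trivial) w hw
      subst this
      infer_instance
    | succ n ih =>
      intro W hW
      have hJW : IsNoetherian K (J • W : Submodule R E) := by
        refine ih _ fun a ha x hx ↦ ?_
        refine Submodule.smul_induction_on hx (fun b hb w hw ↦ ?_) fun x y hx hy ↦ by
          rw [smul_add, hx, hy, add_zero]
        rw [← mul_smul]
        exact hW _ (by rw [J.pow_succ]; exact Submodule.mul_mem_mul ha hb) w hw
      obtain ⟨s, hs⟩ := (IsNoetherian.noetherian (J.restrictScalars K) : Submodule.FG _)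
      have hsJ : ∀ a ∈ s, a ∈ J := fun a ha ↦
        (hs.le (Submodule.subset_span ha) : a ∈ J.restrictScalars K)
      let F : W →ₗ[K] (s → (J • W : Submodule R E)) :=
        LinearMap.pi fun a ↦
          { toFun := fun w ↦ ⟨(a : R) • (w : E), Submodule.smul_mem_smul (hsJ a a.2) w.2⟩
            map_add' := fun x y ↦ Subtype.ext (by simp)
            map_smul' := fun c x ↦ Subtype.ext (smul_comm (a : R) c (x : E)) }
      let W' : Submodule R E :=
        { carrier := {w | w ∈ W ∧ ∀ a ∈ J, a • w = 0}
          add_mem' := fun hx hy ↦ ⟨W.add_mem hx.1 hy.1, fun a ha ↦ by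
            rw [smul_add, hx.2 a ha, hy.2 a ha, add_zero]⟩
          zero_mem' := ⟨W.zero_mem, fun a _ ↦ smul_zero a⟩
          smul_mem' := fun c x hx ↦ ⟨W.smul_mem c hx.1, fun a ha ↦ by
            rw [← mul_smul]; exact hx.2 _ (Ideal.mul_mem_right _ _ ha)⟩ }
      have hW'Y : W' ≤ Y := hss W' fun a ha w hw ↦ hw.2 a ha
      have hker : IsNoetherian K (LinearMap.ker F) := by
        let G : LinearMap.ker F →ₗ[K] Y :=
          { toFun := fun w ↦ ⟨w.1.1, hW'Y ⟨w.1.2, fun a ha ↦ by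
              have ha' : a ∈ Submodule.span K (s : Set R) := by rw [hs]; exact ha
              induction ha' using Submodule.span_induction with
              | mem x hx =>
                exact congrArg Subtype.val (congrFun (LinearMap.mem_ker.1 w.2) ⟨x, hx⟩)
              | zero => simp
              | add x y hx hy h1 h2 =>
                rw [add_smul, h1 (hs.le hx), h2 (hs.le hy), add_zero]
              | smul c x hx h1 => rw [smul_assoc, h1 (hs.le hx), smul_zero]⟩⟩
            map_add' := fun x y ↦ rfl
            map_smul' := fun c x ↦ rfl }
        exact isNoetherian_of_injective G fun x y h ↦
          Subtype.ext (Subtype.ext (congrArg Subtype.val h :))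
      exact isNoetherian_of_range_eq_ker (LinearMap.ker F).subtype F.rangeRestrict (by simp)
  obtain ⟨n, hn⟩ := IsSemiprimaryRing.isNilpotent (R := R)
  have := key n ⊤ fun a ha w _ ↦ by
    rw [hn] at ha
    simp [(Submodule.mem_bot R).1 ha]
  exact isNoetherian_of_linearEquiv ((Submodule.topEquiv (R := R) (M := E)).restrictScalars K)

/-- A finitely generated module over an artin algebra embeds in a finitely generated injective
module. -/
theorem exists_finite_injective (K : Type u) [CommRing K] [IsArtinianRing K] [Algebra K R]
    [Module.Finite K R] (Y : Type u) [AddCommGroup Y] [Module R Y] [Module.Finite R Y] :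
    ∃ (I : ModuleCat.{u} R) (f : Y →ₗ[R] I), Module.Finite R I ∧ Module.Injective R I ∧
      Function.Injective f := by
  let P : CategoryTheory.InjectivePresentation (ModuleCat.of R Y) := Classical.arbitrary _
  let Q : ModuleCat.{u} R := P.J
  have hQ : Module.Injective R Q :=
    (Module.injective_iff_injective_object R Q).2 P.injective
  let f : Y →ₗ[R] Q := P.f.hom
  have hf : Function.Injective f := (ModuleCat.mono_iff_injective P.f).1 P.mono
  obtain ⟨E, hYE, hE, hess⟩ := exists_essential_injective_submodule (LinearMap.range f)
  let _ : Module K Q := Module.compHom Q (algebraMap K R)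
  have : IsScalarTower K R Q := ⟨fun c a x ↦ by
    rw [Algebra.smul_def, mul_smul]; rfl⟩
  let Y' : Submodule R E := (LinearMap.range f).comap E.subtype
  have : Module.Finite R Y' := Module.Finite.equiv
    (Submodule.comapSubtypeEquivOfLe hYE).symm
  have : Module.Finite K Y' := Module.Finite.trans R Y'
  have : IsNoetherian K Y' := inferInstance
  have : IsNoetherian K E := isNoetherian_of_essential K Y' fun V hV ↦ by
    have := hess (V.map E.subtype) (Submodule.map_subtype_le E V) (by
      rw [Submodule.eq_bot_iff]
      rintro x ⟨⟨v, hv, rfl⟩, hx⟩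
      simpa using hV.le (show v ∈ V ⊓ Y' from ⟨hv, hx⟩))
    exact Submodule.map_injective_of_injective E.subtype_injective (by simpa using this)
  refine ⟨ModuleCat.of R E, f.codRestrict E fun x ↦ hYE ⟨x, rfl⟩,
    Module.Finite.of_restrictScalars_finite K R E, hE, fun x y h ↦ hf (congrArg Subtype.val h :)⟩

end InjectiveHull

section LinearMapLemmas

variable {R : Type u} [Ring R] {M N L : Type u} [AddCommGroup M] [Module R M]
  [AddCommGroup N] [Module R N] [AddCommGroup L] [Module R L]

theorem LinearMap.exists_comp_eq_of_ker_le {f : M →ₗ[R] N} (hf : Function.Surjective f)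
    (h : M →ₗ[R] L) (hker : LinearMap.ker f ≤ LinearMap.ker h) : ∃ k : N →ₗ[R] L, k ∘ₗ f = h :=
  ⟨(LinearMap.ker f).liftQ h hker ∘ₗ (f.quotKerEquivOfSurjective hf).symm, LinearMap.ext fun x ↦ by
    have : (f.quotKerEquivOfSurjective hf).symm (f x) = Submodule.Quotient.mk x := by
      rw [LinearEquiv.symm_apply_eq]; rfl
    simp [this]⟩

theorem LinearMap.exists_comp_eq_of_range_le {f : N →ₗ[R] M} (hf : Function.Injective f)
    (h : L →ₗ[R] M) (hrange : LinearMap.range h ≤ LinearMap.range f) :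
    ∃ k : L →ₗ[R] N, f ∘ₗ k = h := by
  let k : L →ₗ[R] LinearMap.range f :=
    LinearMap.codRestrict (LinearMap.range f) h fun x ↦ hrange (LinearMap.mem_range_self h x)
  exact ⟨(LinearEquiv.ofInjective f hf).symm.toLinearMap ∘ₗ k,
    LinearMap.ext fun x ↦
      congrArg Subtype.val ((LinearEquiv.ofInjective f hf).apply_symm_apply (k x))⟩

theorem exists_section_of_retraction {i : M →ₗ[R] N} {p : N →ₗ[R] L}
    (hp : Function.Surjective p) (hex : LinearMap.range i = LinearMap.ker p) (r : N →ₗ[R] M)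
    (hr : r ∘ₗ i = LinearMap.id) : ∃ s : L →ₗ[R] N, p ∘ₗ s = LinearMap.id := by
  have h := (LinearMap.exact_iff.2 hex.symm).split_tfae'
  have h' := h.out 1 0
  exact (h'.1 ⟨hp, r, hr⟩).2

end LinearMapLemmas

section Indecomposable

theorem Indec.eq_id {M : Modc A} (hM : Indec M) {e : M →ₗ[Aᵐᵒᵖ] M} (he : e ∘ₗ e = e)
    (h0 : e ≠ 0) : e = LinearMap.id :=
  (hM.2 e he).resolve_left h0

/-- A surjection onto an indecomposable module splits as soon as some nonzero retract of its source
is a retract via a projection vanishing on its kernel. -/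
theorem Indec.exists_section {E X Z : Modc A} (hX : Indec X) [Nontrivial Z] {p : E →ₗ[Aᵐᵒᵖ] X}
    (hp : Function.Surjective p) {ι : Z →ₗ[Aᵐᵒᵖ] E} {π : E →ₗ[Aᵐᵒᵖ] Z}
    (hπι : π ∘ₗ ι = LinearMap.id) (hker : LinearMap.ker p ≤ LinearMap.ker π) :
    ∃ s : X →ₗ[Aᵐᵒᵖ] E, p ∘ₗ s = LinearMap.id := by
  obtain ⟨q, hq⟩ := LinearMap.exists_comp_eq_of_ker_le hp π hker
  have hqz : ∀ z, q (p (ι z)) = z := fun z ↦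
    (LinearMap.congr_fun hq (ι z)).trans (LinearMap.congr_fun hπι z)
  refine ⟨ι ∘ₗ q, hX.eq_id (e := p ∘ₗ ι ∘ₗ q) (LinearMap.ext fun x ↦ ?_) fun h ↦ ?_⟩
  · simp [hqz]
  · obtain ⟨z, hz⟩ := exists_ne (0 : Z)
    apply hz
    have := congrArg q (LinearMap.congr_fun h (p (ι z)))
    simpa [hqz] using this

/-- An injection from an indecomposable module splits as soon as its image contains a nonzero
retract of its target. -/
theorem Indec.exists_retraction {E Y Z : Modc A} (hY : Indec Y) [Nontrivial Z]
    {i : Y →ₗ[Aᵐᵒᵖ] E} (hi : Function.Injective i) {ι : Z →ₗ[Aᵐᵒᵖ] E} {π : E →ₗ[Aᵐᵒᵖ] Z}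
    (hπι : π ∘ₗ ι = LinearMap.id) (hrange : LinearMap.range ι ≤ LinearMap.range i) :
    ∃ r : E →ₗ[Aᵐᵒᵖ] Y, r ∘ₗ i = LinearMap.id := by
  obtain ⟨q, hq⟩ := LinearMap.exists_comp_eq_of_range_le hi ι hrange
  have hqz : ∀ z, π (i (q z)) = z := fun z ↦
    (congrArg π (LinearMap.congr_fun hq z)).trans (LinearMap.congr_fun hπι z)
  refine ⟨q ∘ₗ π, hY.eq_id (e := (q ∘ₗ π) ∘ₗ i) (LinearMap.ext fun x ↦ ?_) fun h ↦ ?_⟩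
  · simp [hqz]
  · obtain ⟨z, hz⟩ := exists_ne (0 : Z)
    apply hz
    have := congrArg (π ∘ₗ i) (LinearMap.congr_fun h (q z))
    simpa [hqz] using this

/-- A decomposition of a module into finitely many finitely generated indecomposables. -/
structure IndecDecomposition (M : Modc A) where
  /-- The index set. -/
  J : Type
  [fintype : Fintype J]
  /-- The summands. -/
  Z : J → Modc A
  /-- The inclusions. -/
  ι : ∀ j, Z j →ₗ[Aᵐᵒᵖ] M
  /-- The projections. -/
  π : ∀ j, M →ₗ[Aᵐᵒᵖ] Z j
  finGen : ∀ j, FinGen (Z j)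
  indec : ∀ j, Indec (Z j)
  π_ι : ∀ j, π j ∘ₗ ι j = LinearMap.id
  sum_ι_π : ∀ m, ∑ j, ι j (π j m) = m

attribute [instance] IndecDecomposition.fintype

namespace IndecDecomposition

variable {M : Modc A} (D : IndecDecomposition M)

theorem nontrivial (j : D.J) : Nontrivial (D.Z j) := (D.indec j).1

theorem exists_comp_ι_ne_zero {N : Modc A} {f : M →ₗ[Aᵐᵒᵖ] N} (hf : f ≠ 0) :
    ∃ j, f ∘ₗ D.ι j ≠ 0 := by
  by_contra! h
  refine hf (LinearMap.ext fun m ↦ ?_)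
  rw [← D.sum_ι_π m, map_sum]
  exact Finset.sum_eq_zero fun j _ ↦ LinearMap.congr_fun (h j) (D.π j m)

theorem exists_π_comp_ne_zero {N : Modc A} {f : N →ₗ[Aᵐᵒᵖ] M} (hf : f ≠ 0) :
    ∃ j, D.π j ∘ₗ f ≠ 0 := by
  by_contra! h
  refine hf (LinearMap.ext fun n ↦ ?_)
  rw [← D.sum_ι_π (f n)]
  exact Finset.sum_eq_zero fun j _ ↦ by
    rw [show D.π j (f n) = 0 from LinearMap.congr_fun (h j) n, map_zero]

theorem ι_ne_zero (j : D.J) : D.ι j ≠ 0 := fun h ↦ by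
  obtain ⟨z, hz⟩ := @exists_ne _ (D.nontrivial j) 0
  exact hz (by simpa [h] using (LinearMap.congr_fun (D.π_ι j) z).symm)

end IndecDecomposition

/-- Over an artinian ring, finitely generated modules decompose into indecomposables. -/
theorem FinGen.nonempty_indecDecomposition [IsArtinianRing Aᵐᵒᵖ] {M : Modc A} (hM : FinGen M) :
    Nonempty (IndecDecomposition M) := by
  induction hn : (Module.length Aᵐᵒᵖ M).toNat using Nat.strong_induction_on generalizing M with
  | _ n ih =>
  have : Module.Finite Aᵐᵒᵖ M := hM
  have ih' : ∀ N : Submodule Aᵐᵒᵖ M, N ≠ ⊤ →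
      Nonempty (IndecDecomposition (ModuleCat.of Aᵐᵒᵖ N)) := fun N hN ↦
    ih _ (by
      rw [← hn]
      rw [← ENat.natCast_lt_natCast, ENat.natCast_toNat Module.length_ne_top,
        ENat.natCast_toNat Module.length_ne_top]
      exact Submodule.length_lt hN)
      (M := ModuleCat.of Aᵐᵒᵖ N) (inferInstanceAs (Module.Finite Aᵐᵒᵖ N)) rfl
  cases subsingleton_or_nontrivial M with
  | inl h => exact ⟨⟨Empty, Empty.elim, fun j ↦ j.elim, fun j ↦ j.elim, fun j ↦ j.elim,
      fun j ↦ j.elim, fun j ↦ j.elim, fun m ↦ Subsingleton.elim _ _⟩⟩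
  | inr h =>
  by_cases hind : Indec M
  · exact ⟨⟨Unit, fun _ ↦ M, fun _ ↦ LinearMap.id, fun _ ↦ LinearMap.id, fun _ ↦ hM,
      fun _ ↦ hind, fun _ ↦ rfl, fun m ↦ by simp⟩⟩
  · simp only [Indec, h, true_and, not_forall, not_or] at hind
    obtain ⟨e, he, he0, he1⟩ := hind
    have he' : ∀ m, e (e m) = e m := LinearMap.congr_fun he
    have hr : LinearMap.range e ≠ ⊤ := fun htop ↦ he1 (LinearMap.ext fun m ↦ by
      obtain ⟨x, rfl⟩ := LinearMap.range_eq_top.1 htop m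
      exact he' x)
    have hk : LinearMap.ker e ≠ ⊤ := fun htop ↦ he0 (LinearMap.ker_eq_top.1 htop)
    obtain ⟨D₁⟩ := ih' _ hr
    obtain ⟨D₂⟩ := ih' _ hk
    let q₁ : M →ₗ[Aᵐᵒᵖ] LinearMap.range e := e.rangeRestrict
    let q₂ : M →ₗ[Aᵐᵒᵖ] LinearMap.ker e :=
      (LinearMap.id - e).codRestrict _ fun m ↦ by simp [he']
    have hq₁ : ∀ m : LinearMap.range e, q₁ m = m := by
      rintro ⟨-, x, rfl⟩
      exact Subtype.ext (he' x)
    have hq₂ : ∀ m : LinearMap.ker e, q₂ m = m := fun m ↦ Subtype.ext (by simp [q₂])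
    refine ⟨⟨D₁.J ⊕ D₂.J, Sum.elim D₁.Z D₂.Z,
      fun j ↦ match j with
        | .inl j => (LinearMap.range e).subtype ∘ₗ D₁.ι j
        | .inr j => (LinearMap.ker e).subtype ∘ₗ D₂.ι j,
      fun j ↦ match j with
        | .inl j => D₁.π j ∘ₗ q₁
        | .inr j => D₂.π j ∘ₗ q₂, ?_, ?_, ?_, ?_⟩⟩
    · rintro (j | j)
      exacts [D₁.finGen j, D₂.finGen j]
    · rintro (j | j)
      exacts [D₁.indec j, D₂.indec j]
    · rintro (j | j)
      · refine LinearMap.ext fun z ↦ ?_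
        exact (congrArg (D₁.π j) (hq₁ (D₁.ι j z))).trans (LinearMap.congr_fun (D₁.π_ι j) z)
      · refine LinearMap.ext fun z ↦ ?_
        exact (congrArg (D₂.π j) (hq₂ (D₂.ι j z))).trans (LinearMap.congr_fun (D₂.π_ι j) z)
    · intro m
      have h₁ := congrArg (LinearMap.range e).subtype (D₁.sum_ι_π (q₁ m))
      have h₂ := congrArg (LinearMap.ker e).subtype (D₂.sum_ι_π (q₂ m))
      rw [map_sum] at h₁ h₂
      rw [Fintype.sum_sum_type]
      refine (congrArg₂ (· + ·) h₁ h₂).trans ?_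
      simp [q₁, q₂]

end Indecomposable

section Extensions

/-- Every map from `X` to a quotient `E / q(I)`, with `E` finitely generated and `I` finitely
generated injective, lifts to `E`; that is, `Ext¹(X, Y) = 0` for all quotients `Y` of finitely
generated injective modules. -/
def LiftsModInjective (X : Modc A) : Prop :=
  ∀ (I E W : Modc A) (q : I →ₗ[Aᵐᵒᵖ] E) (p : E →ₗ[Aᵐᵒᵖ] W) (ψ : X →ₗ[Aᵐᵒᵖ] W),
    FinGen I → FinGen E → Module.Injective Aᵐᵒᵖ I → Function.Surjective p →
    LinearMap.range q = LinearMap.ker p → ∃ φ : X →ₗ[Aᵐᵒᵖ] E, p ∘ₗ φ = ψ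

/-- Every map to `Y` from the kernel of a map `E → P` between finitely generated projective
modules extends to `E`; that is, `Ext¹(U, Y) = 0` for all finitely generated submodules `U` of
projective modules. -/
def ExtendsFromSyzygies (Y : Modc A) : Prop :=
  ∀ (W E P : Modc A) (i : W →ₗ[Aᵐᵒᵖ] E) (j : E →ₗ[Aᵐᵒᵖ] P) (ψ : W →ₗ[Aᵐᵒᵖ] Y),
    FinGen E → FinGen P → Module.Projective Aᵐᵒᵖ E → Module.Projective Aᵐᵒᵖ P →
    Function.Injective i → LinearMap.range i = LinearMap.ker j →
    ∃ φ : E →ₗ[Aᵐᵒᵖ] Y, φ ∘ₗ i = ψ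

theorem LiftsModInjective.of_indecDecomposition {X : Modc A} (D : IndecDecomposition X)
    (h : ∀ j, LiftsModInjective (D.Z j)) : LiftsModInjective X := by
  intro I E W q p ψ hI hE hinj hp hex
  choose φ hφ using fun j ↦ h j I E W q p (ψ ∘ₗ D.ι j) hI hE hinj hp hex
  refine ⟨∑ j, φ j ∘ₗ D.π j, LinearMap.ext fun x ↦ ?_⟩
  calc _ = ∑ j, p (φ j (D.π j x)) := by simp
    _ = ∑ j, ψ (D.ι j (D.π j x)) :=
      Finset.sum_congr rfl fun j _ ↦ LinearMap.congr_fun (hφ j) _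
    _ = ψ x := by rw [← map_sum, D.sum_ι_π]

theorem ExtendsFromSyzygies.of_indecDecomposition {Y : Modc A} (D : IndecDecomposition Y)
    (h : ∀ j, ExtendsFromSyzygies (D.Z j)) : ExtendsFromSyzygies Y := by
  intro W E P i j ψ hE hP hE' hP' hi hex
  choose φ hφ using fun k ↦ h k W E P i j (D.π k ∘ₗ ψ) hE hP hE' hP' hi hex
  refine ⟨∑ k, D.ι k ∘ₗ φ k, LinearMap.ext fun x ↦ ?_⟩
  calc _ = ∑ k, D.ι k (φ k (i x)) := by simp
    _ = ∑ k, D.ι k (D.π k (ψ x)) :=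
      Finset.sum_congr rfl fun k _ ↦ congrArg (D.ι k) (LinearMap.congr_fun (hφ k) x)
    _ = ψ x := D.sum_ι_π _

theorem LiftsModInjective.of_sections [IsNoetherianRing Aᵐᵒᵖ] {X : Modc A} (hX : FinGen X)
    (h : ∀ (I E : Modc A) (q : I →ₗ[Aᵐᵒᵖ] E) (p : E →ₗ[Aᵐᵒᵖ] X),
      FinGen I → FinGen E → Module.Injective Aᵐᵒᵖ I → Function.Surjective p →
      LinearMap.range q = LinearMap.ker p → ∃ s : X →ₗ[Aᵐᵒᵖ] E, p ∘ₗ s = LinearMap.id) :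
    LiftsModInjective X := by
  intro I E W q p ψ hI hE hinj hp hex
  have : Module.Finite Aᵐᵒᵖ X := hX
  have : Module.Finite Aᵐᵒᵖ E := hE
  have hpq : ∀ b, p (q b) = 0 := fun b ↦ hex.le ⟨b, rfl⟩
  let G : Submodule Aᵐᵒᵖ (X × E) :=
    LinearMap.ker (ψ ∘ₗ LinearMap.fst Aᵐᵒᵖ X E - p ∘ₗ LinearMap.snd Aᵐᵒᵖ X E)
  have hG : ∀ z : G, ψ z.1.1 = p z.1.2 := fun z ↦ sub_eq_zero.1 z.2
  obtain ⟨s, hs⟩ := h I (ModuleCat.of Aᵐᵒᵖ G)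
    ((LinearMap.inr Aᵐᵒᵖ X E ∘ₗ q).codRestrict G fun b ↦ by simp [G, hpq])
    (LinearMap.fst Aᵐᵒᵖ X E ∘ₗ G.subtype) hI (inferInstanceAs (Module.Finite Aᵐᵒᵖ G)) hinj
    (fun x ↦ by
      obtain ⟨e, he⟩ := hp (ψ x)
      exact ⟨⟨(x, e), by simp [G, he]⟩, rfl⟩)
    (by
      ext ⟨⟨x, e⟩, hz⟩
      have hz' : ψ x = p e := hG ⟨_, hz⟩
      constructor
      · rintro ⟨b, hb⟩
        exact (congrArg (fun z : G ↦ z.1.1) hb).symm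
      · intro hx
        have hx' : x = 0 := hx
        subst hx'
        obtain ⟨b, rfl⟩ := hex.ge (show e ∈ LinearMap.ker p by simpa using hz'.symm)
        exact ⟨b, rfl⟩)
  refine ⟨LinearMap.snd Aᵐᵒᵖ X E ∘ₗ G.subtype ∘ₗ s, LinearMap.ext fun x ↦ ?_⟩
  exact (hG (s x)).symm.trans (congrArg ψ (LinearMap.congr_fun hs x))

theorem ExtendsFromSyzygies.of_retractions {Y : Modc A} (hY : FinGen Y)
    (h : ∀ (E P : Modc A) (i : Y →ₗ[Aᵐᵒᵖ] E) (j : E →ₗ[Aᵐᵒᵖ] P),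
      FinGen E → FinGen P → Module.Projective Aᵐᵒᵖ P → Function.Injective i →
      LinearMap.range i = LinearMap.ker j → ∃ r : E →ₗ[Aᵐᵒᵖ] Y, r ∘ₗ i = LinearMap.id) :
    ExtendsFromSyzygies Y := by
  intro W E P i j ψ hE hP _ hP' hi hex
  have : Module.Finite Aᵐᵒᵖ Y := hY
  have : Module.Finite Aᵐᵒᵖ E := hE
  have hji : ∀ w, j (i w) = 0 := fun w ↦ hex.le ⟨w, rfl⟩
  let S : Submodule Aᵐᵒᵖ (E × Y) := LinearMap.range (i.prod (-ψ))
  have hS : ∀ w, S.mkQ (i w, 0) = S.mkQ (0, ψ w) := fun w ↦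
    (Submodule.Quotient.eq S).2 ⟨w, by simp⟩
  let j' : (E × Y) ⧸ S →ₗ[Aᵐᵒᵖ] P := S.liftQ (j ∘ₗ LinearMap.fst Aᵐᵒᵖ E Y) (by
    rintro _ ⟨w, rfl⟩
    exact hji w)
  obtain ⟨r, hr⟩ := h (ModuleCat.of Aᵐᵒᵖ ((E × Y) ⧸ S)) P
    (S.mkQ ∘ₗ LinearMap.inr Aᵐᵒᵖ E Y) j' (inferInstanceAs (Module.Finite Aᵐᵒᵖ ((E × Y) ⧸ S)))
    hP hP'
    (by
      rw [← LinearMap.ker_eq_bot, Submodule.eq_bot_iff]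
      intro y hy
      obtain ⟨w, hw⟩ := (Submodule.Quotient.mk_eq_zero S).1 hy
      have h1 : i w = 0 := congrArg Prod.fst hw
      have h2 : -ψ w = y := congrArg Prod.snd hw
      rw [← h2, (map_eq_zero_iff i hi).1 h1, map_zero, neg_zero])
    (by
      ext z
      obtain ⟨⟨e, y⟩, rfl⟩ := S.mkQ_surjective z
      constructor
      · rintro ⟨y', hy'⟩
        rw [← hy']
        exact map_zero j
      · intro hz
        obtain ⟨w, rfl⟩ := hex.ge (show e ∈ LinearMap.ker j from hz)
        refine ⟨ψ w + y, ?_⟩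
        calc S.mkQ (0, ψ w + y) = S.mkQ (0, ψ w) + S.mkQ (0, y) := by
              rw [← map_add]; simp
          _ = S.mkQ (i w, y) := by
              rw [← hS, ← map_add]; simp)
  refine ⟨r ∘ₗ S.mkQ ∘ₗ LinearMap.inl Aᵐᵒᵖ E Y, LinearMap.ext fun w ↦ ?_⟩
  exact (congrArg r (hS w)).trans (LinearMap.congr_fun hr (ψ w))

/-- If `X` satisfies `LiftsModInjective`, then its syzygies are projective. -/
theorem LiftsModInjective.projective_syzygy [IsNoetherianRing Aᵐᵒᵖ]
    (henough : ∀ Y : Modc A, FinGen Y → ∃ (I : Modc A) (f : Y →ₗ[Aᵐᵒᵖ] I),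
      FinGen I ∧ Module.Injective Aᵐᵒᵖ I ∧ Function.Injective f)
    {X Ω P : Modc A} (hX : LiftsModInjective X) (hP : FinGen P)
    [Module.Projective Aᵐᵒᵖ P] {i : Ω →ₗ[Aᵐᵒᵖ] P} {g : P →ₗ[Aᵐᵒᵖ] X}
    (hi : Function.Injective i) (hg : Function.Surjective g)
    (hex : LinearMap.range i = LinearMap.ker g) : Module.Projective Aᵐᵒᵖ Ω := by
  have : Module.Finite Aᵐᵒᵖ P := hP
  have : Module.Finite Aᵐᵒᵖ Ω := Module.Finite.of_injective i hi
  have hgi : ∀ w, g (i w) = 0 := fun w ↦ hex.le ⟨w, rfl⟩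
  obtain ⟨n, φ, hφ⟩ := Module.Finite.exists_fin' Aᵐᵒᵖ Ω
  let Y := LinearMap.ker φ
  obtain ⟨I, u, hI, hinj, hu⟩ :=
    henough (ModuleCat.of Aᵐᵒᵖ Y) (inferInstanceAs (Module.Finite Aᵐᵒᵖ Y))
  have : Module.Finite Aᵐᵒᵖ I := hI
  obtain ⟨v, hv⟩ := Module.Injective.out (Y.subtype) Y.subtype_injective u
  let S : Submodule Aᵐᵒᵖ (P × I) := LinearMap.range ((i ∘ₗ φ).prod v)
  have hS : ∀ z, S.mkQ (i (φ z), 0) = - S.mkQ (0, v z) := fun z ↦ by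
    rw [← map_neg]
    exact (Submodule.Quotient.eq S).2 ⟨z, by simp⟩
  let p : (P × I) ⧸ S →ₗ[Aᵐᵒᵖ] X := S.liftQ (g ∘ₗ LinearMap.fst Aᵐᵒᵖ P I) (by
    rintro _ ⟨w, rfl⟩
    exact hgi (φ w))
  have hpq : LinearMap.range (S.mkQ ∘ₗ LinearMap.inr Aᵐᵒᵖ P I) = LinearMap.ker p := by
    ext z
    obtain ⟨⟨a, b⟩, rfl⟩ := S.mkQ_surjective z
    constructor
    · rintro ⟨b', hb'⟩
      rw [← hb']
      exact map_zero g
    · intro hz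
      obtain ⟨w, rfl⟩ := hex.ge (show a ∈ LinearMap.ker g from hz)
      obtain ⟨z, rfl⟩ := hφ w
      refine ⟨b - v z, ?_⟩
      calc S.mkQ (0, b - v z) = S.mkQ (0, b) + - S.mkQ (0, v z) := by
            rw [← map_neg, ← map_add]; simp [sub_eq_add_neg]
        _ = S.mkQ (i (φ z), b) := by
            rw [← hS, ← map_add]; simp
  obtain ⟨s, hs⟩ := hX I (ModuleCat.of Aᵐᵒᵖ ((P × I) ⧸ S)) X
    (S.mkQ ∘ₗ LinearMap.inr Aᵐᵒᵖ P I) p LinearMap.id hI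
    (inferInstanceAs (Module.Finite Aᵐᵒᵖ ((P × I) ⧸ S))) hinj
    (fun x ↦ by
      obtain ⟨a, rfl⟩ := hg x
      exact ⟨S.mkQ (a, 0), rfl⟩) hpq
  let t : P →ₗ[Aᵐᵒᵖ] LinearMap.ker p :=
    (S.mkQ ∘ₗ LinearMap.inl Aᵐᵒᵖ P I - s ∘ₗ g).codRestrict _ fun a ↦ by
      have : p (s (g a)) = g a := LinearMap.congr_fun hs (g a)
      change p (S.mkQ (a, 0) - s (g a)) = 0
      rw [map_sub, this]
      exact sub_self _
  let q' : I →ₗ[Aᵐᵒᵖ] LinearMap.ker p :=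
    (S.mkQ ∘ₗ LinearMap.inr Aᵐᵒᵖ P I).codRestrict _ fun b ↦ hpq.le ⟨b, rfl⟩
  obtain ⟨w, hw⟩ := Module.projective_lifting_property q' t (by
    rintro ⟨z, hz⟩
    obtain ⟨b, rfl⟩ := hpq.ge hz
    exact ⟨b, rfl⟩)
  have hw' : ∀ a, S.mkQ (0, w a) = S.mkQ (a, 0) - s (g a) := fun a ↦
    congrArg Subtype.val (LinearMap.congr_fun hw a)
  obtain ⟨ρ, hρ⟩ := LinearMap.exists_comp_eq_of_range_le hu (w ∘ₗ i ∘ₗ φ + v) (by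
    rintro _ ⟨z, rfl⟩
    have hmem : ((0 : P), w (i (φ z)) + v z) ∈ S := by
      rw [← Submodule.Quotient.mk_eq_zero, ← Submodule.mkQ_apply]
      calc S.mkQ (0, w (i (φ z)) + v z) = S.mkQ (0, w (i (φ z))) + S.mkQ (0, v z) := by
            rw [← map_add]; simp
        _ = 0 := by rw [hw', hgi, map_zero, sub_zero, hS, neg_add_cancel]
    obtain ⟨z', hz'⟩ := hmem
    have h1 : φ z' = 0 := (map_eq_zero_iff i hi).1 (congrArg Prod.fst hz')
    have h2 : v z' = w (i (φ z)) + v z := congrArg Prod.snd hz'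
    exact ⟨⟨z', h1⟩, (hv ⟨z', h1⟩).symm.trans h2⟩)
  obtain ⟨σ, hσ⟩ := exists_section_of_retraction (i := Y.subtype) hφ (by simp [Y]) ρ
    (LinearMap.ext fun y ↦ hu (by
      have h1 : φ y = 0 := y.2
      have := LinearMap.congr_fun hρ y
      simp only [LinearMap.comp_apply, LinearMap.add_apply, h1, map_zero, zero_add] at this
      exact this.trans (hv y)))
  exact Module.Projective.of_split σ φ hσ

theorem LiftsModInjective.pdLE1 [IsNoetherianRing Aᵐᵒᵖ]
    (henough : ∀ Y : Modc A, FinGen Y → ∃ (I : Modc A) (f : Y →ₗ[Aᵐᵒᵖ] I),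
      FinGen I ∧ Module.Injective Aᵐᵒᵖ I ∧ Function.Injective f)
    {X : Modc A} (hX : LiftsModInjective X) (hfin : FinGen X) : PdLE1 X := by
  have : Module.Finite Aᵐᵒᵖ X := hfin
  obtain ⟨n, g, hg⟩ := Module.Finite.exists_fin' Aᵐᵒᵖ X
  let P : Modc A := ModuleCat.of Aᵐᵒᵖ (Fin n → Aᵐᵒᵖ)
  have : Module.Projective Aᵐᵒᵖ P := inferInstanceAs (Module.Projective Aᵐᵒᵖ (Fin n → Aᵐᵒᵖ))
  refine ⟨ModuleCat.of Aᵐᵒᵖ (LinearMap.ker g), P, (LinearMap.ker g).subtype, g, ?_, this,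
    Subtype.val_injective, hg, by simp⟩
  exact hX.projective_syzygy (P := P) (Ω := ModuleCat.of Aᵐᵒᵖ (LinearMap.ker g))
    (i := (LinearMap.ker g).subtype) (g := g) henough
    (inferInstanceAs (Module.Finite Aᵐᵒᵖ (Fin n → Aᵐᵒᵖ))) Subtype.val_injective hg
    (by simp)

theorem ExtendsFromSyzygies.idLE1 [IsNoetherianRing Aᵐᵒᵖ]
    {Y : Modc A} (hY : ExtendsFromSyzygies Y) : IdLE1 Y := by
  obtain ⟨I, u, hI, hu⟩ : ∃ (I : Modc A) (f : Y →ₗ[Aᵐᵒᵖ] I),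
      Module.Injective Aᵐᵒᵖ I ∧ Function.Injective f := by
    let P : CategoryTheory.InjectivePresentation Y := Classical.arbitrary _
    exact ⟨P.J, P.f.hom, (Module.injective_iff_injective_object Aᵐᵒᵖ P.J).2 P.injective,
      (ModuleCat.mono_iff_injective P.f).1 P.mono⟩
  let c := (LinearMap.range u).mkQ
  have hcu : ∀ y, c (u y) = 0 := fun y ↦ (Submodule.Quotient.mk_eq_zero _).2 ⟨y, rfl⟩
  refine ⟨I, ModuleCat.of Aᵐᵒᵖ (I ⧸ LinearMap.range u), u, c, hI, ?_, hu,
    Submodule.mkQ_surjective _, by simp [c]⟩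
  refine Module.Baer.injective fun 𝔞 h ↦ ?_
  obtain ⟨n, φ, hφ⟩ := Module.Finite.exists_fin' Aᵐᵒᵖ 𝔞
  let Q : Modc A := ModuleCat.of Aᵐᵒᵖ (Fin n → Aᵐᵒᵖ)
  have hQ : Module.Projective Aᵐᵒᵖ Q := inferInstanceAs (Module.Projective Aᵐᵒᵖ (Fin n → Aᵐᵒᵖ))
  have hQ' : FinGen Q := inferInstanceAs (Module.Finite Aᵐᵒᵖ (Fin n → Aᵐᵒᵖ))
  obtain ⟨v, hv⟩ := Module.projective_lifting_property (P := Fin n → Aᵐᵒᵖ) c (h ∘ₗ φ)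
    (Submodule.mkQ_surjective _)
  obtain ⟨ψ, hψ⟩ := LinearMap.exists_comp_eq_of_range_le hu (v ∘ₗ (LinearMap.ker φ).subtype) (by
    rintro _ ⟨z, rfl⟩
    rw [← Submodule.Quotient.mk_eq_zero, ← Submodule.mkQ_apply]
    exact (LinearMap.congr_fun hv z).trans
      ((congrArg h (show φ z = 0 from z.2)).trans (map_zero h)))
  obtain ⟨χ, hχ⟩ := hY (ModuleCat.of Aᵐᵒᵖ (LinearMap.ker φ)) Q (ModuleCat.of Aᵐᵒᵖ Aᵐᵒᵖ)
    (LinearMap.ker φ).subtype (𝔞.subtype ∘ₗ φ) ψ hQ'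
    (inferInstanceAs (Module.Finite Aᵐᵒᵖ Aᵐᵒᵖ)) hQ
    (inferInstanceAs (Module.Projective Aᵐᵒᵖ Aᵐᵒᵖ)) Subtype.val_injective
    (by rw [LinearMap.ker_comp_of_ker_eq_bot _ 𝔞.ker_subtype]; simp)
  obtain ⟨k, hk⟩ := LinearMap.exists_comp_eq_of_ker_le hφ (v - u ∘ₗ χ) (fun z hz ↦ by
    have h1 := LinearMap.congr_fun hψ ⟨z, hz⟩
    have h2 := congrArg u (LinearMap.congr_fun hχ ⟨z, hz⟩)
    exact sub_eq_zero.2 (h1.symm.trans h2.symm))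
  obtain ⟨l, hl⟩ := Module.Injective.out 𝔞.subtype 𝔞.subtype_injective k
  refine ⟨c ∘ₗ l, fun x hx ↦ ?_⟩
  obtain ⟨z, hz⟩ := hφ ⟨x, hx⟩
  calc c (l x) = c (k (φ z)) := by rw [hz]; exact congrArg c (hl ⟨x, hx⟩)
    _ = c (v z) - c (u (χ z)) := by
      rw [← map_sub]; exact congrArg c (LinearMap.congr_fun hk z)
    _ = h ⟨x, hx⟩ := by
      rw [hcu, sub_zero, ← hz]; exact LinearMap.congr_fun hv z

end Extensions

section Component

variable {C : Set (Modc A)}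

/-- In the absence of external short paths, a component contains every indecomposable lying
between two of its members. -/
theorem IsARComponent.mem_of_path (hC : IsARComponent C) (hne : ¬ HasExtShortPath C)
    {X Y Z : Modc A} (hX : X ∈ C) (hZ : Z ∈ C) (hY : FinGen Y) (hYi : Indec Y)
    {f : X →ₗ[Aᵐᵒᵖ] Y} (hf : f ≠ 0) {g : Y →ₗ[Aᵐᵒᵖ] Z} (hg : g ≠ 0) : Y ∈ C := by
  by_contra hYC
  have hiso : ∀ W ∈ C, IsEmpty (W ≃ₗ[Aᵐᵒᵖ] Y) := fun W hW ↦ ⟨fun e ↦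
    hYC (hC.2.2.1 W hW Y ⟨(hC.2.1 W hW).1, hY, (hC.2.1 W hW).2, hYi, .inl ⟨e⟩⟩)⟩
  exact hne ⟨X, Y, Z, hX, hZ, hYC, hY, hYi,
    ⟨f, hf, fun h ↦ (hiso X hX).false (LinearEquiv.ofBijective f h)⟩,
    ⟨g, hg, fun h ↦ (hiso Z hZ).false (LinearEquiv.ofBijective g h).symm⟩⟩

theorem exists_smul_ne_zero_of_annSet (hfaith : annSet C = {0}) {a : Aᵐᵒᵖ} (ha : a ≠ 0) :
    ∃ X ∈ C, ∃ x : X, a • x ≠ 0 := by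
  by_contra! h
  have : a.unop ∈ annSet C := fun X hX x ↦ h X hX x
  rw [hfaith] at this
  exact ha (MulOpposite.unop_injective this)

/-- Finitely many elements of members of a faithful class already detect nonzero scalars. -/
theorem exists_finite_faithful_family [IsArtinianRing Aᵐᵒᵖ] (hfaith : annSet C = {0}) :
    ∃ (n : ℕ) (X : Fin n → Modc A) (x : ∀ i, X i), (∀ i, X i ∈ C) ∧
      ∀ a : Aᵐᵒᵖ, (∀ i, a • x i = 0) → a = 0 := by
  classical
  let N : (Σ X : C, X.1) → Submodule Aᵐᵒᵖ Aᵐᵒᵖ := fun p ↦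
    LinearMap.ker (LinearMap.toSpanSingleton Aᵐᵒᵖ p.1.1 p.2)
  obtain ⟨_, ⟨s, rfl⟩, hs⟩ := IsArtinian.set_has_minimal
    (Set.range fun s : Finset (Σ X : C, X.1) ↦ s.inf N) (Set.range_nonempty _)
  refine ⟨s.card, fun i ↦ (s.equivFin.symm i).1.1.1, fun i ↦ (s.equivFin.symm i).1.2,
    fun i ↦ (s.equivFin.symm i).1.1.2, fun a ha ↦ ?_⟩
  by_contra ha0
  obtain ⟨X, hX, x, hx⟩ := exists_smul_ne_zero_of_annSet hfaith ha0
  have has : a ∈ s.inf N := (Submodule.mem_finsetInf).2 fun p hp ↦ by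
    have h : a • (s.equivFin.symm (s.equivFin ⟨p, hp⟩)).1.2 = 0 := ha (s.equivFin ⟨p, hp⟩)
    rwa [Equiv.symm_apply_apply] at h
  let p : Σ X : C, X.1 := ⟨⟨X, hX⟩, x⟩
  refine hs _ ⟨insert p s, rfl⟩ (lt_of_le_of_ne (Finset.inf_mono (Finset.subset_insert p s)) ?_)
  intro h
  have has' : a ∈ (insert p s).inf N := h.ge has
  exact hx ((Submodule.mem_finsetInf).1 has' p (Finset.mem_insert_self p s))

theorem exists_comp_ne_zero_of_projective (hfaith : annSet C = {0}) {F P : Modc A}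
    (hP : Module.Projective Aᵐᵒᵖ P) {f : F →ₗ[Aᵐᵒᵖ] P} (hf : f ≠ 0) :
    ∃ X ∈ C, ∃ g : P →ₗ[Aᵐᵒᵖ] X, g ∘ₗ f ≠ 0 := by
  obtain ⟨s, hs⟩ := hP.out
  obtain ⟨y, hy⟩ := DFunLike.ne_iff.1 hf
  have hsy : s (f y) ≠ 0 := fun h ↦ hy (by rw [← hs (f y), h, map_zero]; rfl)
  obtain ⟨b, hb⟩ := DFunLike.ne_iff.1 hsy
  obtain ⟨X, hX, x, hx⟩ := exists_smul_ne_zero_of_annSet hfaith hb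
  exact ⟨X, hX, LinearMap.toSpanSingleton Aᵐᵒᵖ X x ∘ₗ Finsupp.lapply b ∘ₗ s,
    fun h ↦ hx (LinearMap.congr_fun h y)⟩

theorem exists_comp_ne_zero_of_injective [IsArtinianRing Aᵐᵒᵖ] (hfaith : annSet C = {0})
    {I E : Modc A} (hI : Module.Injective Aᵐᵒᵖ I) {f : I →ₗ[Aᵐᵒᵖ] E} (hf : f ≠ 0) :
    ∃ X ∈ C, ∃ g : X →ₗ[Aᵐᵒᵖ] I, f ∘ₗ g ≠ 0 := by
  obtain ⟨n, X, x, hX, hx⟩ := exists_finite_faithful_family hfaith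
  obtain ⟨b, hb⟩ := DFunLike.ne_iff.1 hf
  obtain ⟨h, hh⟩ := Module.Injective.out (LinearMap.toSpanSingleton Aᵐᵒᵖ (∀ i, X i) x)
    ((injective_iff_map_eq_zero _).2 fun a ha ↦ hx a fun i ↦ congrFun ha i)
    (LinearMap.toSpanSingleton Aᵐᵒᵖ I b)
  have hb' : h x = b := by simpa using hh 1
  by_contra! hzero
  refine hb ?_
  rw [← hb', ← LinearMap.sum_single_apply (fun i ↦ X i) x, map_sum, map_sum]
  exact Finset.sum_eq_zero fun i _ ↦
    LinearMap.congr_fun (hzero (X i) (hX i) (h ∘ₗ LinearMap.single Aᵐᵒᵖ (fun i ↦ X i) i)) (x i)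

/-- Indecomposables mapping nontrivially to a faithful regular component without external short
paths satisfy `LiftsModInjective`. -/
theorem IsARComponent.liftsModInjective [IsArtinianRing Aᵐᵒᵖ] (hC : IsARComponent C)
    (hreg : ∀ X ∈ C, ¬ Module.Injective Aᵐᵒᵖ X)
    (hfaith : annSet C = {0}) (hne : ¬ HasExtShortPath C) {Z N : Modc A} (hZ : FinGen Z)
    (hZi : Indec Z) (hN : N ∈ C) {g : Z →ₗ[Aᵐᵒᵖ] N} (hg : g ≠ 0) : LiftsModInjective Z := by
  refine .of_sections hZ fun I E q p hI hE hinj hp hex ↦ ?_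
  by_contra hsec
  obtain ⟨D⟩ := hE.nonempty_indecDecomposition
  obtain ⟨D'⟩ := hI.nonempty_indecDecomposition
  have hgp : g ∘ₗ p ≠ 0 := fun h ↦ hg (LinearMap.ext fun z ↦ by
    obtain ⟨e, rfl⟩ := hp z
    exact LinearMap.congr_fun h e)
  obtain ⟨i, hi⟩ := D.exists_comp_ι_ne_zero hgp
  have hπq : D.π i ∘ₗ q ≠ 0 := fun h ↦ hsec (by
    have := D.nontrivial i
    refine hZi.exists_section hp (D.π_ι i) ?_
    rw [← hex]
    rintro _ ⟨b, rfl⟩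
    exact LinearMap.congr_fun h b)
  have hE_mem : D.Z i ∈ C := by
    obtain ⟨X, hX, u, hu⟩ := exists_comp_ne_zero_of_injective hfaith hinj hπq
    exact hC.mem_of_path hne hX hN (D.finGen i) (D.indec i) hu hi
  obtain ⟨k, hk⟩ := D'.exists_comp_ι_ne_zero hπq
  have hIk : Module.Injective Aᵐᵒᵖ (D'.Z k) := .of_retract (D'.ι k) (D'.π k) (D'.π_ι k)
  obtain ⟨X, hX, u, hu⟩ := exists_comp_ne_zero_of_injective hfaith hIk hk
  have hu0 : u ≠ 0 := by
    rintro rfl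
    exact hu (LinearMap.comp_zero _)
  exact hreg _ (hC.mem_of_path hne hX hE_mem (D'.finGen k) (D'.indec k) hu0 hk) hIk

/-- Indecomposables receiving a nonzero map from a faithful regular component without external
short paths satisfy `ExtendsFromSyzygies`. -/
theorem IsARComponent.extendsFromSyzygies [IsArtinianRing Aᵐᵒᵖ] (hC : IsARComponent C)
    (hreg : ∀ X ∈ C, ¬ Module.Projective Aᵐᵒᵖ X)
    (hfaith : annSet C = {0}) (hne : ¬ HasExtShortPath C) {X Y : Modc A} (hY : FinGen Y)
    (hYi : Indec Y) (hX : X ∈ C) {x : X →ₗ[Aᵐᵒᵖ] Y} (hx : x ≠ 0) : ExtendsFromSyzygies Y := by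
  refine .of_retractions hY fun E P i j hE hP hproj hi hex ↦ ?_
  by_contra hret
  obtain ⟨D⟩ := hE.nonempty_indecDecomposition
  obtain ⟨D'⟩ := hP.nonempty_indecDecomposition
  have hix : i ∘ₗ x ≠ 0 := fun h ↦ hx (LinearMap.ext fun z ↦
    hi ((LinearMap.congr_fun h z).trans (map_zero i).symm))
  obtain ⟨k, hk⟩ := D.exists_π_comp_ne_zero hix
  have hjι : j ∘ₗ D.ι k ≠ 0 := fun h ↦ hret (by
    have := D.nontrivial k
    refine hYi.exists_retraction hi (D.π_ι k) ?_
    rw [hex]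
    rintro _ ⟨z, rfl⟩
    exact LinearMap.congr_fun h z)
  have hE_mem : D.Z k ∈ C := by
    obtain ⟨X', hX', u, hu⟩ := exists_comp_ne_zero_of_projective hfaith hproj hjι
    exact hC.mem_of_path hne hX hX' (D.finGen k) (D.indec k) hk hu
  obtain ⟨l, hl⟩ := D'.exists_π_comp_ne_zero hjι
  have hPl : Module.Projective Aᵐᵒᵖ (D'.Z l) := .of_split (D'.ι l) (D'.π l) (D'.π_ι l)
  obtain ⟨X', hX', u, hu⟩ := exists_comp_ne_zero_of_projective hfaith hPl hl
  have hu0 : u ≠ 0 := by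
    rintro rfl
    exact hu (LinearMap.zero_comp _)
  exact hreg _ (hC.mem_of_path hne hE_mem hX' (D'.finGen l) (D'.indec l) hl hu0) hPl

theorem IsARComponent.liftsModInjective_of_injective [IsArtinianRing Aᵐᵒᵖ]
    (hC : IsARComponent C) (hreg : ∀ X ∈ C, ¬ Module.Injective Aᵐᵒᵖ X)
    (hfaith : annSet C = {0}) (hne : ¬ HasExtShortPath C) {U P : Modc A} (hU : FinGen U)
    (hP : Module.Projective Aᵐᵒᵖ P) {i : U →ₗ[Aᵐᵒᵖ] P} (hi : Function.Injective i) :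
    LiftsModInjective U := by
  obtain ⟨D⟩ := hU.nonempty_indecDecomposition
  refine .of_indecDecomposition D fun j ↦ ?_
  have hij : i ∘ₗ D.ι j ≠ 0 := fun h ↦ D.ι_ne_zero j (LinearMap.ext fun z ↦
    hi ((LinearMap.congr_fun h z).trans (map_zero i).symm))
  obtain ⟨X, hX, g, hg⟩ := exists_comp_ne_zero_of_projective hfaith hP hij
  exact hC.liftsModInjective hreg hfaith hne (D.finGen j) (D.indec j) hX hg

/-- In the presence of a faithful regular component without external short paths, a surjection
`p : E → X` onto an indecomposable, without section and with kernel a quotient of an injective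
module, forces `ExtendsFromSyzygies E`. -/
theorem IsARComponent.extendsFromSyzygies_of_no_section [IsArtinianRing Aᵐᵒᵖ]
    (hC : IsARComponent C) (hreg : ∀ X ∈ C, ¬ Module.Projective Aᵐᵒᵖ X)
    (hfaith : annSet C = {0}) (hne : ¬ HasExtShortPath C) {I E X : Modc A}
    {q : I →ₗ[Aᵐᵒᵖ] E} {p : E →ₗ[Aᵐᵒᵖ] X} (hX : Indec X) (hE : FinGen E)
    (hinj : Module.Injective Aᵐᵒᵖ I) (hp : Function.Surjective p)
    (hex : LinearMap.range q = LinearMap.ker p)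
    (hsec : ¬ ∃ s : X →ₗ[Aᵐᵒᵖ] E, p ∘ₗ s = LinearMap.id) : ExtendsFromSyzygies E := by
  obtain ⟨D⟩ := hE.nonempty_indecDecomposition
  refine .of_indecDecomposition D fun i ↦ ?_
  have hπq : D.π i ∘ₗ q ≠ 0 := fun h ↦ hsec (by
    have := D.nontrivial i
    refine hX.exists_section hp (D.π_ι i) ?_
    rw [← hex]
    rintro _ ⟨b, rfl⟩
    exact LinearMap.congr_fun h b)
  obtain ⟨X', hX', u, hu⟩ := exists_comp_ne_zero_of_injective hfaith hinj hπq
  exact hC.extendsFromSyzygies hreg hfaith hne (D.finGen i) (D.indec i) hX' hu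

theorem IsARComponent.pdLE2 [IsArtinianRing Aᵐᵒᵖ]
    (henough : ∀ Y : Modc A, FinGen Y → ∃ (I : Modc A) (f : Y →ₗ[Aᵐᵒᵖ] I),
      FinGen I ∧ Module.Injective Aᵐᵒᵖ I ∧ Function.Injective f)
    (hC : IsARComponent C) (hreg : ∀ X ∈ C, ¬ Module.Injective Aᵐᵒᵖ X)
    (hfaith : annSet C = {0}) (hne : ¬ HasExtShortPath C) {X : Modc A} (hX : FinGen X) :
    PdLE2 X := by
  have : Module.Finite Aᵐᵒᵖ X := hX
  obtain ⟨n, g, hg⟩ := Module.Finite.exists_fin' Aᵐᵒᵖ X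
  let P : Modc A := ModuleCat.of Aᵐᵒᵖ (Fin n → Aᵐᵒᵖ)
  have hP : Module.Projective Aᵐᵒᵖ P := inferInstanceAs (Module.Projective Aᵐᵒᵖ (Fin n → Aᵐᵒᵖ))
  let Ω : Modc A := ModuleCat.of Aᵐᵒᵖ (LinearMap.ker g)
  have hΩ : Module.Finite Aᵐᵒᵖ Ω := inferInstanceAs (Module.Finite Aᵐᵒᵖ (LinearMap.ker g))
  let i : Ω →ₗ[Aᵐᵒᵖ] P := (LinearMap.ker g).subtype
  obtain ⟨P₂, P₁, f, h, hP₂, hP₁, hf, hh, hex⟩ :=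
    (hC.liftsModInjective_of_injective hreg hfaith hne hΩ hP (i := i)
      Subtype.val_injective).pdLE1 henough hΩ
  have hi : LinearMap.ker i = ⊥ := (LinearMap.ker g).ker_subtype
  refine ⟨P₂, P₁, P, f, i ∘ₗ h, g, hP₂, hP₁, hP, hf, hg, ?_, ?_⟩
  · rw [hex, LinearMap.ker_comp_of_ker_eq_bot _ hi]
  · rw [LinearMap.range_comp_of_range_eq_top _ (LinearMap.range_eq_top.2 hh)]
    exact (LinearMap.ker g).range_subtype

/-- In the presence of a faithful regular component without external short paths,
`ExtendsFromSyzygies` passes to quotients. -/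
theorem IsARComponent.extendsFromSyzygies_of_surjective [IsArtinianRing Aᵐᵒᵖ]
    (henough : ∀ Y : Modc A, FinGen Y → ∃ (I : Modc A) (f : Y →ₗ[Aᵐᵒᵖ] I),
      FinGen I ∧ Module.Injective Aᵐᵒᵖ I ∧ Function.Injective f)
    (hC : IsARComponent C) (hreg : ∀ X ∈ C, ¬ Module.Injective Aᵐᵒᵖ X)
    (hfaith : annSet C = {0}) (hne : ¬ HasExtShortPath C) {E X : Modc A}
    (hE : ExtendsFromSyzygies E) {p : E →ₗ[Aᵐᵒᵖ] X} (hp : Function.Surjective p) :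
    ExtendsFromSyzygies X := by
  intro W E₀ P i j ψ hE₀ hP hE₀' hP' hi hex
  have : Module.Finite Aᵐᵒᵖ E₀ := hE₀
  let U : Modc A := ModuleCat.of Aᵐᵒᵖ (LinearMap.range j)
  have hU : LiftsModInjective U := hC.liftsModInjective_of_injective hreg hfaith hne
    (inferInstanceAs (Module.Finite Aᵐᵒᵖ (LinearMap.range j))) hP'
    (i := (LinearMap.range j).subtype) Subtype.val_injective
  have hW : Module.Projective Aᵐᵒᵖ W := hU.projective_syzygy henough hE₀ (g := j.rangeRestrict)
    hi j.surjective_rangeRestrict (by rw [hex, LinearMap.ker_rangeRestrict])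
  obtain ⟨ψ', hψ'⟩ := Module.projective_lifting_property p ψ hp
  obtain ⟨φ, hφ⟩ := hE W E₀ P i j ψ' hE₀ hP hE₀' hP' hi hex
  exact ⟨p ∘ₗ φ, by rw [LinearMap.comp_assoc, hφ, hψ']⟩

end Component

/-- If `C` is a faithful regular component of `Γ_A` without
external short paths, then every `N ∈ C` has `pd ≤ 1` and `id ≤ 1`,
`gldim A ≤ 2`, and `A` is quasi-tilted. -/
theorem quasiTilted_of_faithful_regular_component
    (K : Type u) [CommRing K] [IsArtinianRing K]
    (A : Type u) [Ring A] [Algebra K A] [Module.Finite K A]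
    (C : Set (Modc A)) (hC : IsARComponent C)
    (hreg : ∀ X ∈ C, ¬ Module.Projective Aᵐᵒᵖ X ∧ ¬ Module.Injective Aᵐᵒᵖ X)
    (hfaith : annSet C = {0}) (hne : ¬ HasExtShortPath C) :
    (∀ N ∈ C, PdLE1 N ∧ IdLE1 N) ∧
    (∀ X : Modc A, FinGen X → PdLE2 X) ∧
    (∀ X : Modc A, FinGen X → Indec X → PdLE1 X ∨ IdLE1 X) := by
  have : Module.Finite K Aᵐᵒᵖ := Module.Finite.equiv (MulOpposite.opLinearEquiv K)
  have : IsArtinianRing Aᵐᵒᵖ := IsArtinianRing.of_finite K Aᵐᵒᵖ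
  have hproj : ∀ X ∈ C, ¬ Module.Projective Aᵐᵒᵖ X := fun X hX ↦ (hreg X hX).1
  have hinj : ∀ X ∈ C, ¬ Module.Injective Aᵐᵒᵖ X := fun X hX ↦ (hreg X hX).2
  have henough : ∀ Y : Modc A, FinGen Y → ∃ (I : Modc A) (f : Y →ₗ[Aᵐᵒᵖ] I),
      FinGen I ∧ Module.Injective Aᵐᵒᵖ I ∧ Function.Injective f := fun Y hY ↦ by
    have : Module.Finite Aᵐᵒᵖ Y := hY
    exact exists_finite_injective K Y
  refine ⟨fun N hN ↦ ?_, fun X hX ↦ hC.pdLE2 henough hinj hfaith hne hX, fun X hX hXi ↦ ?_⟩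
  · obtain ⟨hfin, hind⟩ := hC.2.1 N hN
    have hid : (LinearMap.id : N →ₗ[Aᵐᵒᵖ] N) ≠ 0 := fun h ↦ by
      obtain ⟨z, hz⟩ := @exists_ne _ hind.1 (0 : N)
      exact hz (LinearMap.congr_fun h z)
    exact ⟨(hC.liftsModInjective hinj hfaith hne hfin hind hN hid).pdLE1 henough hfin,
      (hC.extendsFromSyzygies hproj hfaith hne hfin hind hN hid).idLE1⟩
  · by_cases hlift : LiftsModInjective X
    · exact .inl (hlift.pdLE1 henough hX)
    · right
      by_contra hid
      refine hlift (.of_sections hX fun I E q p _ hE hI hp hex ↦ ?_)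
      by_contra hsec
      have hE' := hC.extendsFromSyzygies_of_no_section hproj hfaith hne hXi hE hI hp hex hsec
      exact hid (hC.extendsFromSyzygies_of_surjective henough hinj hfaith hne hE' hp).idLE1
end
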